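/- arXiv:2412.19546 — 3 statements merged into one kernel-verified Lean document; each statement's English description precedes it below -/
import Mathlib

section
/- Let (Ω, F) be a measurable space and w a capacity on (Ω, F) that is continuous at ∅: w(A_n) → 0 whenever (A_n) is a decreasing sequence in F with ⋂_n A_n = ∅. Let α ∈ (0,1) and assume the capacity w_α(A) = min(w(A)/α, 1) is submodular. Then for every bounded F-measurable X : Ω → ℝ, the set {∫ X dQ : Q a probability measure on (Ω, F) with Q(A) ≤ w(A)/α for all A ∈ F} is nonempty and its supremum equals ES^w_α(X): ES^w_α(X) = sup{∫ X dQ : Q a probability measure on (Ω, F), Q(A) ≤ w(A)/α for all A ∈ F}. -/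
open MeasureTheory Set Filter

/-- A capacity on a measurable space: `w ∅ = 0`, `w Ω = 1`, and `w` is monotone
on measurable sets. -/
def IsCapacity {Ω : Type*} [MeasurableSpace Ω] (w : Set Ω → ℝ) : Prop :=
  w ∅ = 0 ∧ w Set.univ = 1 ∧
    ∀ ⦃A B : Set Ω⦄, MeasurableSet A → MeasurableSet B → A ⊆ B → w A ≤ w B

/-- The Value-at-Risk of level `t` under a capacity `w`:
`VaR^w_t (X) = inf {x | w {X ≥ x} ≤ t}`. -/
noncomputable def VaRc {Ω : Type*} [MeasurableSpace Ω]
    (w : Set Ω → ℝ) (t : ℝ) (X : Ω → ℝ) : ℝ :=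
  sInf {x : ℝ | w {ω | x ≤ X ω} ≤ t}

section Lattice

variable {L : Type*}

/-- A monotone submodular function on a distributive lattice dominates a monotone submodular one
that agrees with it on a given set `C` and is modular with respect to every element comparable to
all elements of `C`. -/
theorem exists_le_modular_of_comparable [DistribLattice L] [OrderBot L] {v : L → ℝ}
    (hv : Monotone v) (hsub : ∀ a b, v (a ⊔ b) + v (a ⊓ b) ≤ v a + v b)
    (C : Set L) (hbot : ⊥ ∈ C) :
    ∃ u ≤ v, Monotone u ∧ (∀ a b, u (a ⊔ b) + u (a ⊓ b) ≤ u a + u b) ∧ (∀ c ∈ C, u c = v c) ∧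
      ∀ b, (∀ c ∈ C, b ≤ c ∨ c ≤ b) → ∀ a, u (a ⊔ b) + u (a ⊓ b) = u a + u b := by
  let P : Set (L → ℝ) := {u | Monotone u ∧ (∀ a b, u (a ⊔ b) + u (a ⊓ b) ≤ u a + u b) ∧
    ∀ c ∈ C, u c = v c}
  have hinf : ∀ K ⊆ P, IsChain (· ≤ ·) K → ∀ y ∈ K, ∃ lb ∈ P, ∀ z ∈ K, lb ≤ z := by
    intro K hK hchain y hy
    have : Nonempty K := ⟨⟨y, hy⟩⟩
    have hbdd : ∀ a, BddBelow (range fun u : K => u.1 a) := by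
      refine fun a => ⟨v ⊥, ?_⟩
      rintro _ ⟨u, rfl⟩
      exact ((hK u.2).2.2 ⊥ hbot).symm.trans_le ((hK u.2).1 bot_le)
    refine ⟨fun a => ⨅ u : K, u.1 a, ⟨fun a b hab => ?_, fun a b => ?_, fun c hc => ?_⟩,
      fun z hz a => ciInf_le (hbdd a) ⟨z, hz⟩⟩
    · exact ciInf_mono (hbdd a) fun u => (hK u.2).1 hab
    · refine le_of_forall_pos_le_add fun ε hε => ?_
      obtain ⟨u₁, h₁⟩ := exists_lt_of_ciInf_lt
        (show (⨅ u : K, u.1 a) < (⨅ u : K, u.1 a) + ε / 2 by linarith)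
      obtain ⟨u₂, h₂⟩ := exists_lt_of_ciInf_lt
        (show (⨅ u : K, u.1 b) < (⨅ u : K, u.1 b) + ε / 2 by linarith)
      obtain ⟨u, hu₁, hu₂⟩ : ∃ u : K, u.1 ≤ u₁.1 ∧ u.1 ≤ u₂.1 := by
        rcases hchain.total u₁.2 u₂.2 with h | h
        · exact ⟨u₁, le_rfl, h⟩
        · exact ⟨u₂, h, le_rfl⟩
      have := (hK u.2).2.1 a b
      have := ciInf_le (hbdd (a ⊔ b)) u
      have := ciInf_le (hbdd (a ⊓ b)) u
      have := hu₁ a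
      have := hu₂ b
      linarith
    · exact (iInf_congr fun u : K => (hK u.2).2.2 c hc).trans ciInf_const
  obtain ⟨u, huv, hu, hmin⟩ := zorn_le_nonempty₀ (α := (L → ℝ)ᵒᵈ) P
    (fun K hK hc => hinf K hK hc.symm) v ⟨hv, hsub, fun _ _ => rfl⟩
  obtain ⟨hmono, husub, huC⟩ := hu
  refine ⟨u, huv, hmono, husub, huC, fun b hb a => ?_⟩
  have hle : ∀ a, u (a ⊓ b) + u (a ⊔ b) - u b ≤ u a := fun a => by linarith [husub a b]
  have hP : (fun a => u (a ⊓ b) + u (a ⊔ b) - u b) ∈ P := by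
    refine ⟨fun x y hxy => ?_, fun x y => ?_, fun c hc => ?_⟩
    · have := hmono (inf_le_inf_right b hxy)
      have := hmono (sup_le_sup_right hxy b)
      simp only
      linarith
    · have h₁ := husub (x ⊓ b) (y ⊓ b)
      have h₂ := husub (x ⊔ b) (y ⊔ b)
      rw [← inf_sup_right, ← inf_inf_distrib_right] at h₁
      rw [← sup_inf_right, ← sup_sup_distrib_right] at h₂
      simp only
      linarith
    · rw [← huC c hc]
      rcases hb c hc with h | h
      · simp [inf_eq_right.2 h, sup_eq_left.2 h]
      · simp [inf_eq_left.2 h, sup_eq_right.2 h]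
  have := hmin hP hle a
  linarith [husub a b]

/-- A monotone submodular function on a Boolean algebra dominates a monotone modular one agreeing
with it on a given chain, at `⊥` and at `⊤`. -/
theorem exists_le_modular_eqOn_chain [BooleanAlgebra L] {v : L → ℝ}
    (hv : Monotone v) (hsub : ∀ a b, v (a ⊔ b) + v (a ⊓ b) ≤ v a + v b)
    {C : Set L} (hC : IsChain (· ≤ ·) C) :
    ∃ u ≤ v, Monotone u ∧ (∀ a b, u (a ⊔ b) + u (a ⊓ b) = u a + u b) ∧ u ⊥ = v ⊥ ∧ u ⊤ = v ⊤ ∧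
      ∀ c ∈ C, u c = v c := by
  obtain ⟨u₁, hle₁, hmono₁, hsub₁, heq₁, hmod₁⟩ :=
    exists_le_modular_of_comparable hv hsub (insert ⊥ (insert ⊤ C)) (by simp)
  obtain ⟨u, hle, hmono, -, heq, hmod⟩ :=
    exists_le_modular_of_comparable hmono₁ hsub₁ {⊥, ⊤} (by simp)
  have hbot : u ⊥ = u₁ ⊥ := heq ⊥ (by simp)
  have htop : u ⊤ = u₁ ⊤ := heq ⊤ (by simp)
  have hmod' : ∀ a b, u (a ⊔ b) + u (a ⊓ b) = u a + u b := fun a b => hmod b (by simp) a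
  refine ⟨u, hle.trans hle₁, hmono, hmod', hbot.trans (heq₁ ⊥ (by simp)),
    htop.trans (heq₁ ⊤ (by simp)), fun c hc => ?_⟩
  rw [← heq₁ c (by simp [hc])]
  have h₁ := hmod₁ c (by simpa using fun d hd => hC.total hc hd) cᶜ
  have h₂ := hmod' cᶜ c
  rw [compl_sup_eq_top, compl_inf_eq_bot] at h₁ h₂
  linarith [hle c, hle cᶜ]

end Lattice

/-- A normalized finitely additive set function that is continuous at `∅` is a probability
measure. -/
theorem exists_probabilityMeasure_of_modular {Ω : Type*} [MeasurableSpace Ω]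
    {u : Subtype (MeasurableSet : Set Ω → Prop) → ℝ} (hmono : Monotone u)
    (hmod : ∀ a b, u (a ⊔ b) + u (a ⊓ b) = u a + u b) (hbot : u ⊥ = 0) (htop : u ⊤ = 1)
    (hcont : ∀ A : ℕ → Subtype (MeasurableSet : Set Ω → Prop), Antitone A →
      (⋂ k, (A k : Set Ω)) = ∅ → Tendsto (fun k => u (A k)) atTop (nhds 0)) :
    ∃ Q : Measure Ω, IsProbabilityMeasure Q ∧
      ∀ A (hA : MeasurableSet A), Q A = ENNReal.ofReal (u ⟨A, hA⟩) := by
  classical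
  have hnonneg : ∀ a, 0 ≤ u a := fun a => hbot.symm.trans_le (hmono bot_le)
  have hring : IsSetRing {A : Set Ω | MeasurableSet A} :=
    ⟨MeasurableSet.empty, fun _ _ => MeasurableSet.union, fun _ _ => MeasurableSet.diff⟩
  let f : Set Ω → ENNReal := fun A =>
    if hA : MeasurableSet A then ENNReal.ofReal (u ⟨A, hA⟩) else 0
  have hf : ∀ A (hA : MeasurableSet A), f A = ENNReal.ofReal (u ⟨A, hA⟩) := fun A hA => dif_pos hA
  have hf_empty : f ∅ = 0 := by
    rw [hf ∅ MeasurableSet.empty, ENNReal.ofReal_eq_zero]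
    exact hbot.le
  let m : AddContent ENNReal {A : Set Ω | MeasurableSet A} :=
    hring.addContent_of_union f hf_empty fun {s t} hs ht hst => by
      have hinf : (⟨s, hs⟩ ⊓ ⟨t, ht⟩ : Subtype (MeasurableSet : Set Ω → Prop)) = ⊥ :=
        Subtype.ext hst.inter_eq
      have h := hmod ⟨s, hs⟩ ⟨t, ht⟩
      rw [hinf, hbot, add_zero] at h
      rw [hf s hs, hf t ht, hf _ (hs.union ht), ← ENNReal.ofReal_add (hnonneg _) (hnonneg _), ← h]
      rfl
  have hm : ∀ A (hA : MeasurableSet A), m A = ENNReal.ofReal (u ⟨A, hA⟩) := hf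
  have hsum := addContent_iUnion_eq_sum_of_tendsto_zero hring m
    (fun s hs => by rw [hm s hs]; exact ENNReal.ofReal_ne_top)
    (fun s hs hanti hempty => by
      have h := ENNReal.tendsto_ofReal (hcont (fun n => ⟨s n, hs n⟩) hanti hempty)
      rw [ENNReal.ofReal_zero] at h
      exact h.congr fun n => (hm (s n) (hs n)).symm)
  let Q : Measure Ω := Measure.ofMeasurable (fun A _ => m A) hf_empty
    fun g hg hd => hsum hg (MeasurableSet.iUnion hg) hd
  have hQ : ∀ A (hA : MeasurableSet A), Q A = ENNReal.ofReal (u ⟨A, hA⟩) := fun A hA =>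
    (Measure.ofMeasurable_apply A hA).trans (hm A hA)
  refine ⟨Q, ⟨?_⟩, hQ⟩
  rw [hQ _ MeasurableSet.univ, ← ENNReal.ofReal_one, ← htop]
  rfl

/-- Stochastic dominance between functions bounded below implies the inequality of the
integrals. -/
theorem integral_le_integral_of_measure_lt_le {Ω Ω' : Type*} [MeasurableSpace Ω]
    [MeasurableSpace Ω'] {μ : Measure Ω} {ν : Measure Ω'} [IsProbabilityMeasure μ]
    [IsProbabilityMeasure ν] {f : Ω → ℝ} {g : Ω' → ℝ} (hf : Integrable f μ) (hg : Integrable g ν)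
    {M : ℝ} (hfM : ∀ᵐ ω ∂μ, -M ≤ f ω) (hgM : ∀ᵐ ω ∂ν, -M ≤ g ω)
    (h : ∀ x, μ {ω | x < f ω} ≤ ν {ω | x ≤ g ω}) :
    ∫ ω, f ω ∂μ ≤ ∫ ω, g ω ∂ν := by
  have hf' : Integrable (fun ω => f ω + M) μ := hf.add (integrable_const M)
  have hg' : Integrable (fun ω => g ω + M) ν := hg.add (integrable_const M)
  have hf0 : 0 ≤ᵐ[μ] fun ω => f ω + M := hfM.mono fun ω hω => by
    simp only [Pi.zero_apply]; linarith
  have hg0 : 0 ≤ᵐ[ν] fun ω => g ω + M := hgM.mono fun ω hω => by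
    simp only [Pi.zero_apply]; linarith
  have key : ∫ ω, (f ω + M) ∂μ ≤ ∫ ω, (g ω + M) ∂ν := by
    rw [integral_eq_lintegral_of_nonneg_ae hf0 hf'.1, integral_eq_lintegral_of_nonneg_ae hg0 hg'.1]
    refine ENNReal.toReal_mono hg'.lintegral_lt_top.ne ?_
    rw [lintegral_eq_lintegral_meas_lt μ hf0 hf'.aemeasurable,
      lintegral_eq_lintegral_meas_le ν hg0 hg'.aemeasurable]
    refine lintegral_mono fun x => ?_
    simpa only [sub_lt_iff_lt_add, sub_le_iff_le_add] using h (x - M)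
  rw [integral_add hf (integrable_const M), integral_add hg (integrable_const M)] at key
  simpa using key

section VaR

variable {Ω : Type*} [MeasurableSpace Ω] {w : Set Ω → ℝ} {X : Ω → ℝ} {M t : ℝ}

theorem nonempty_setOf_capacity_le (hw : IsCapacity w) (hM : ∀ ω, |X ω| ≤ M) (ht : 0 ≤ t) :
    {x : ℝ | w {ω | x ≤ X ω} ≤ t}.Nonempty := by
  refine ⟨M + 1, ?_⟩
  have : {ω | M + 1 ≤ X ω} = ∅ := by
    ext ω
    simpa using by linarith [(abs_le.1 (hM ω)).2]
  simpa [this, hw.1] using ht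

theorem neg_mem_lowerBounds_setOf_capacity_le (hw : IsCapacity w) (hM : ∀ ω, |X ω| ≤ M)
    (ht : t < 1) : -M ∈ lowerBounds {x : ℝ | w {ω | x ≤ X ω} ≤ t} := by
  intro x hx
  by_contra! hlt
  have : {ω | x ≤ X ω} = Set.univ := by
    ext ω
    simpa using by linarith [(abs_le.1 (hM ω)).1]
  rw [mem_ofPred_eq, this, hw.2.1] at hx
  linarith

theorem neg_le_VaRc (hw : IsCapacity w) (hM : ∀ ω, |X ω| ≤ M) (ht₀ : 0 ≤ t) (ht₁ : t < 1) :
    -M ≤ VaRc w t X :=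
  le_csInf (nonempty_setOf_capacity_le hw hM ht₀)
    (neg_mem_lowerBounds_setOf_capacity_le hw hM ht₁)

theorem lt_capacity_of_lt_VaRc (hw : IsCapacity w) (hM : ∀ ω, |X ω| ≤ M) (ht : t < 1) {x : ℝ}
    (hx : x < VaRc w t X) : t < w {ω | x ≤ X ω} :=
  not_le.1 fun h => notMem_of_lt_csInf (s := {x : ℝ | w {ω | x ≤ X ω} ≤ t}) hx
    ⟨_, neg_mem_lowerBounds_setOf_capacity_le hw hM ht⟩ h

theorem le_VaRc_of_lt_capacity (hw : IsCapacity w) (hX : Measurable X) (hM : ∀ ω, |X ω| ≤ M)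
    (ht : 0 ≤ t) {x : ℝ} (hx : t < w {ω | x ≤ X ω}) : x ≤ VaRc w t X := by
  refine le_csInf (nonempty_setOf_capacity_le hw hM ht) fun y hy => ?_
  by_contra! hyx
  exact (hx.trans_le (hw.2.2 (measurableSet_le measurable_const hX)
    (measurableSet_le measurable_const hX) fun ω hω => hyx.le.trans hω)).not_ge hy

theorem antitoneOn_VaRc (hw : IsCapacity w) (hM : ∀ ω, |X ω| ≤ M) :
    AntitoneOn (fun t => VaRc w t X) (Ico 0 1) := fun _ hs _ ht hst =>
  csInf_le_csInf ⟨_, neg_mem_lowerBounds_setOf_capacity_le hw hM ht.2⟩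
    (nonempty_setOf_capacity_le hw hM hs.1) fun _ hx => le_trans hx hst

end VaR

/-- The uniform probability measure on `(0, α]`. -/
noncomputable def uniformIoc (α : ℝ) : Measure ℝ :=
  ENNReal.ofReal (1 / α) • volume.restrict (Ioc 0 α)

section UniformIoc

variable {α : ℝ}

theorem uniformIoc_apply (s : Set ℝ) :
    uniformIoc α s = ENNReal.ofReal (1 / α) * volume (s ∩ Ioc 0 α) := by
  rw [uniformIoc, Measure.smul_apply, Measure.restrict_apply' measurableSet_Ioc, smul_eq_mul]

theorem isProbabilityMeasure_uniformIoc (hα : 0 < α) : IsProbabilityMeasure (uniformIoc α) := by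
  refine ⟨?_⟩
  rw [uniformIoc_apply, univ_inter, Real.volume_Ioc, ← ENNReal.ofReal_mul (by positivity)]
  simp [hα.ne']

theorem integral_uniformIoc (hα : 0 < α) (f : ℝ → ℝ) :
    ∫ t, f t ∂(uniformIoc α) = (1 / α) * ∫ t in (0 : ℝ)..α, f t := by
  rw [uniformIoc, integral_smul_measure, ENNReal.toReal_ofReal (by positivity),
    intervalIntegral.integral_of_le hα.le, smul_eq_mul]

theorem ae_uniformIoc {p : ℝ → Prop} (h : ∀ t ∈ Ioc 0 α, p t) : ∀ᵐ t ∂(uniformIoc α), p t :=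
  Measure.ae_smul_measure (ae_restrict_of_forall_mem measurableSet_Ioc h) _

theorem ofReal_one_div_mul_ofReal_min (hα : 0 < α) (r : ℝ) :
    ENNReal.ofReal (1 / α) * ENNReal.ofReal (min r α) = ENNReal.ofReal (min (r / α) 1) := by
  rw [← ENNReal.ofReal_mul (by positivity), one_div_mul_eq_div, ← min_div_div_right hα.le,
    div_self hα.ne']

variable {Ω : Type*} [MeasurableSpace Ω] {w : Set Ω → ℝ} {X : Ω → ℝ} {M : ℝ}

theorem integrable_VaRc (hw : IsCapacity w) (hM : ∀ ω, |X ω| ≤ M) (hα : α ∈ Ioo (0 : ℝ) 1) :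
    Integrable (fun t => VaRc w t X) (uniformIoc α) := by
  have := isProbabilityMeasure_uniformIoc hα.1
  have hsub : Ioc 0 α ⊆ Ico 0 1 := fun t ht => ⟨ht.1.le, ht.2.trans_lt hα.2⟩
  have hanti := antitoneOn_VaRc hw hM
  refine Integrable.of_mem_Icc (-M) (VaRc w 0 X)
    ((aemeasurable_restrict_of_antitoneOn measurableSet_Ioc (hanti.mono hsub)).smul_measure _)
    (ae_uniformIoc fun t ht => ⟨neg_le_VaRc hw hM (hsub ht).1 (hsub ht).2, ?_⟩)
  exact hanti ⟨le_rfl, one_pos⟩ (hsub ht) ht.1.le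

theorem uniformIoc_lt_VaRc_le (hw : IsCapacity w) (hM : ∀ ω, |X ω| ≤ M) (hα : α ∈ Ioo (0 : ℝ) 1)
    (x : ℝ) : uniformIoc α {t | x < VaRc w t X} ≤
      ENNReal.ofReal (min (w {ω | x ≤ X ω} / α) 1) := by
  rw [uniformIoc_apply, ← ofReal_one_div_mul_ofReal_min hα.1]
  gcongr
  calc volume ({t | x < VaRc w t X} ∩ Ioc 0 α)
      ≤ volume (Ioc 0 (min (w {ω | x ≤ X ω}) α)) := by
        refine measure_mono fun t ht => mem_Ioc.2 ⟨ht.2.1, ?_⟩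
        exact le_min (lt_capacity_of_lt_VaRc hw hM (ht.2.2.trans_lt hα.2) ht.1).le ht.2.2
    _ = _ := by rw [Real.volume_Ioc, sub_zero]

theorem le_uniformIoc_le_VaRc (hw : IsCapacity w) (hX : Measurable X) (hM : ∀ ω, |X ω| ≤ M)
    (hα : 0 < α) (x : ℝ) : ENNReal.ofReal (min (w {ω | x ≤ X ω} / α) 1) ≤
      uniformIoc α {t | x ≤ VaRc w t X} := by
  rw [uniformIoc_apply, ← ofReal_one_div_mul_ofReal_min hα]
  gcongr
  calc ENNReal.ofReal (min (w {ω | x ≤ X ω}) α)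
      = volume (Ioo 0 (min (w {ω | x ≤ X ω}) α)) := by rw [Real.volume_Ioo, sub_zero]
    _ ≤ volume ({t | x ≤ VaRc w t X} ∩ Ioc 0 α) := measure_mono fun t ht => ⟨le_VaRc_of_lt_capacity hw hX hM ht.1.le
        (ht.2.trans_le (min_le_left _ _)), ht.1, ht.2.le.trans (min_le_right _ _)⟩

end UniformIoc

/-- If `min (w / α) 1` is submodular and `w` is continuous at `∅`, some probability measure
`Q ≤ w / α` attains `min (w / α) 1` on all upper level sets of `X`. -/
theorem exists_probabilityMeasure_eq_on_levelSets {Ω : Type*} [MeasurableSpace Ω]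
    {w : Set Ω → ℝ} (hw : IsCapacity w)
    (hcont : ∀ A : ℕ → Set Ω, (∀ k, MeasurableSet (A k)) → Antitone A →
      (⋂ k, A k) = ∅ → Tendsto (fun k => w (A k)) atTop (nhds 0))
    {α : ℝ} (hα : α ∈ Set.Ioo (0 : ℝ) 1)
    (hsubmod : ∀ A B : Set Ω, MeasurableSet A → MeasurableSet B →
      min (w (A ∪ B) / α) 1 + min (w (A ∩ B) / α) 1 ≤ min (w A / α) 1 + min (w B / α) 1)
    {X : Ω → ℝ} (hX : Measurable X) :
    ∃ Q : Measure Ω, IsProbabilityMeasure Q ∧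
      (∀ A : Set Ω, MeasurableSet A → (Q A).toReal ≤ w A / α) ∧
      ∀ x, Q {ω | x ≤ X ω} = ENNReal.ofReal (min (w {ω | x ≤ X ω} / α) 1) := by
  have hlevel : ∀ x, MeasurableSet {ω | x ≤ X ω} := fun x => measurableSet_le measurable_const hX
  let C : Set (Subtype (MeasurableSet : Set Ω → Prop)) := range fun x => ⟨_, hlevel x⟩
  have hC : IsChain (· ≤ ·) C := by
    rintro _ ⟨x, rfl⟩ _ ⟨y, rfl⟩ -
    rcases le_total x y with h | h
    · exact Or.inr fun ω hω => h.trans hω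
    · exact Or.inl fun ω hω => h.trans hω
  obtain ⟨u, hle, hmono, hmod, hbot, htop, heq⟩ :=
    exists_le_modular_eqOn_chain
      (v := fun A : Subtype (MeasurableSet : Set Ω → Prop) => min (w A.1 / α) 1)
      (fun A B hAB => min_le_min_right 1
        (div_le_div_of_nonneg_right (hw.2.2 A.2 B.2 hAB) hα.1.le))
      (fun A B => hsubmod A B A.2 B.2) hC
  have hbot' : u ⊥ = 0 := by
    simp [hbot, hw.1]
  have htop' : u ⊤ = 1 := by
    rw [htop]
    simpa [hw.2.1] using (one_le_inv₀ hα.1).2 hα.2.le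
  have hnonneg : ∀ A, 0 ≤ u A := fun A => hbot'.symm.trans_le (hmono bot_le)
  have hle' : ∀ A, u A ≤ w A.1 / α := fun A => (hle A).trans (min_le_left _ _)
  obtain ⟨Q, hQprob, hQ⟩ := exists_probabilityMeasure_of_modular hmono hmod hbot' htop'
    fun A hA hempty => by
      have h := (hcont (fun k => A k) (fun k => (A k).2) hA hempty).div_const α
      rw [zero_div] at h
      exact squeeze_zero (fun k => hnonneg _) (fun k => hle' _) h
  refine ⟨Q, hQprob, fun A hA => ?_, fun x => ?_⟩
  · rw [hQ A hA, ENNReal.toReal_ofReal (hnonneg _)]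
    exact hle' _
  · rw [hQ _ (hlevel x), heq _ ⟨x, rfl⟩]

/-- Dual (robust) representation of a coherent Choquet Expected Shortfall: for a
capacity `w` continuous at `∅`, `α ∈ (0,1)` with `w_α = min (w/α) 1` submodular, the set
of expectations `∫ X dQ` over probability measures `Q ≤ w/α` is nonempty and its
supremum equals `ES^w_α(X) = (1/α) ∫_0^α VaR^w_t(X) dt`, for every bounded
measurable `X`. -/
theorem choquetES_dual_representation {Ω : Type*} [MeasurableSpace Ω]
    (w : Set Ω → ℝ) (hw : IsCapacity w)
    (hcont : ∀ A : ℕ → Set Ω, (∀ k, MeasurableSet (A k)) → Antitone A →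
      (⋂ k, A k) = ∅ → Tendsto (fun k => w (A k)) atTop (nhds 0))
    (α : ℝ) (hα : α ∈ Set.Ioo (0 : ℝ) 1)
    (hsubmod : ∀ A B : Set Ω, MeasurableSet A → MeasurableSet B →
      min (w (A ∪ B) / α) 1 + min (w (A ∩ B) / α) 1 ≤ min (w A / α) 1 + min (w B / α) 1)
    (X : Ω → ℝ) (hX : Measurable X) (hXb : ∃ M : ℝ, ∀ ω, |X ω| ≤ M)
    (S : Set ℝ)
    (hS : S = {y : ℝ | ∃ Q : Measure Ω, IsProbabilityMeasure Q ∧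
      (∀ A : Set Ω, MeasurableSet A → (Q A).toReal ≤ w A / α) ∧
      y = ∫ ω, X ω ∂Q}) :
    S.Nonempty ∧ sSup S = (1 / α) * ∫ t in (0 : ℝ)..α, VaRc w t X := by
  obtain ⟨M, hM⟩ := hXb
  have hν := isProbabilityMeasure_uniformIoc hα.1
  have hVint := integrable_VaRc hw hM hα
  have hVM : ∀ᵐ t ∂(uniformIoc α), -M ≤ VaRc w t X :=
    ae_uniformIoc fun t ht => neg_le_VaRc hw hM ht.1.le (ht.2.trans_lt hα.2)
  have hXint : ∀ Q : Measure Ω, IsProbabilityMeasure Q → Integrable X Q := fun Q _ =>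
    Integrable.of_bound hX.aestronglyMeasurable M (ae_of_all _ hM)
  have hXM : ∀ Q : Measure Ω, ∀ᵐ ω ∂Q, -M ≤ X ω := fun Q =>
    ae_of_all _ fun ω => (abs_le.1 (hM ω)).1
  rw [← integral_uniformIoc hα.1 fun t => VaRc w t X]
  suffices h : IsGreatest S (∫ t, VaRc w t X ∂(uniformIoc α)) from ⟨h.nonempty, h.csSup_eq⟩
  have hupper : ∫ t, VaRc w t X ∂(uniformIoc α) ∈ upperBounds S := by
    rw [hS]
    rintro _ ⟨Q, hQ, hle, rfl⟩
    refine integral_le_integral_of_measure_lt_le (hXint Q hQ) hVint (hXM Q) hVM fun x => ?_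
    calc Q {ω | x < X ω} ≤ Q {ω | x ≤ X ω} := measure_mono fun ω (hω : x < X ω) => hω.le
      _ = ENNReal.ofReal (Q {ω | x ≤ X ω}).toReal :=
        (ENNReal.ofReal_toReal (measure_ne_top _ _)).symm
      _ ≤ ENNReal.ofReal (min (w {ω | x ≤ X ω} / α) 1) := ENNReal.ofReal_le_ofReal
        (le_min (hle _ (measurableSet_le measurable_const hX)) measureReal_le_one)
      _ ≤ _ := le_uniformIoc_le_VaRc hw hX hM hα.1 x
  refine ⟨?_, hupper⟩
  obtain ⟨Q, hQ, hle, heq⟩ :=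
    exists_probabilityMeasure_eq_on_levelSets hw hcont hα hsubmod hX
  have hmem : ∫ ω, X ω ∂Q ∈ S := by
    rw [hS]
    exact ⟨Q, hQ, hle, rfl⟩
  have hlower : ∫ t, VaRc w t X ∂(uniformIoc α) ≤ ∫ ω, X ω ∂Q :=
    integral_le_integral_of_measure_lt_le hVint (hXint Q hQ) hVM (hXM Q) fun x =>
      (uniformIoc_lt_VaRc_le hw hM hα x).trans_eq (heq x).symm
  rwa [le_antisymm hlower (hupper hmem)]
end

section
/- Let (Ω, F) be a measurable space and let w_1, …, w_n be submodular capacities on (Ω, F). Assume there exists at least one submodular capacity w₀ on (Ω, F) with w₀(A) ≤ min_{1≤i≤n} w_i(A) for all A ∈ F. Then for every bounded F-measurable X : Ω → ℝ, the inf-convolution of the Choquet integrals I_{w_1}, …, I_{w_n} at X satisfies inf{∑_{i=1}^n ∫ X_i dw_i : (X_1,…,X_n) is an allocation of X} = sup{∫ X dw : w a submodular capacity on (Ω, F) with w(A) ≤ min_{1≤i≤n} w_i(A) for all A ∈ F}. -/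
open MeasureTheory Set

/-- A capacity is submodular if `w (A ∪ B) + w (A ∩ B) ≤ w A + w B` on measurable sets. -/
def IsSubmodular {Ω : Type*} [MeasurableSpace Ω] (w : Set Ω → ℝ) : Prop :=
  ∀ ⦃A B : Set Ω⦄, MeasurableSet A → MeasurableSet B →
    w (A ∪ B) + w (A ∩ B) ≤ w A + w B

/-- The Choquet integral `∫ X dw = ∫_{-∞}^0 (w{X ≥ x} - 1) dx + ∫_0^∞ w{X ≥ x} dx`. -/
noncomputable def choquetIntegral {Ω : Type*} [MeasurableSpace Ω]
    (w : Set Ω → ℝ) (X : Ω → ℝ) : ℝ :=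
  (∫ x in Set.Iio (0 : ℝ), (w {ω | x ≤ X ω} - 1)) + ∫ x in Set.Ioi (0 : ℝ), w {ω | x ≤ X ω}

section LevelSum

variable {Ω : Type*} [MeasurableSpace Ω] {w : Set Ω → ℝ}

theorem IsCapacity.nonneg (hw : IsCapacity w) {A : Set Ω} (hA : MeasurableSet A) : 0 ≤ w A := by
  rw [← hw.1]
  exact hw.2.2 MeasurableSet.empty hA (empty_subset A)

theorem IsCapacity.le_one (hw : IsCapacity w) {A : Set Ω} (hA : MeasurableSet A) : w A ≤ 1 := by
  rw [← hw.2.1]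
  exact hw.2.2 hA MeasurableSet.univ (subset_univ A)

theorem IsCapacity.nonempty (hw : IsCapacity w) : Nonempty Ω := by
  by_contra h
  rw [not_nonempty_iff] at h
  have h0 := hw.1
  rw [← univ_eq_empty_iff.2 h, hw.2.1] at h0
  exact one_ne_zero h0

/-- The sum of `w` over the first `K` upper level sets of an `ℕ`-valued function. -/
def levelSum (w : Set Ω → ℝ) (K : ℕ) (f : Ω → ℕ) : ℝ :=
  ∑ k ∈ Finset.range K, w {ω | k + 1 ≤ f ω}

theorem levelSum_mono (hw : IsCapacity w) (K : ℕ) {f g : Ω → ℕ} (hf : Measurable f)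
    (hg : Measurable g) (hfg : ∀ ω, f ω ≤ g ω) : levelSum w K f ≤ levelSum w K g :=
  Finset.sum_le_sum fun _ _ => hw.2.2 (measurableSet_le measurable_const hf)
    (measurableSet_le measurable_const hg) fun ω hω => le_trans hω (hfg ω)

/-- Adding one indicator function to `f` increases the level sum by at most `w A`. -/
theorem levelSum_add_indicator_le (hw : IsCapacity w) (hs : IsSubmodular w) (K : ℕ) {f : Ω → ℕ}
    (hf : Measurable f) {A : Set Ω} (hA : MeasurableSet A) :
    levelSum w K (fun ω => f ω + A.indicator 1 ω) ≤ levelSum w K f + w A := by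
  have hC : ∀ k : ℕ, MeasurableSet {ω | k ≤ f ω} := fun k => measurableSet_le measurable_const hf
  suffices h : levelSum w K (fun ω => f ω + A.indicator 1 ω) + w (A ∩ {ω | K ≤ f ω})
      ≤ levelSum w K f + w A by
    linarith [hw.nonneg (hA.inter (hC K))]
  induction K with
  | zero => simp [levelSum]
  | succ K ih =>
    have hu : {ω | K + 1 ≤ f ω + A.indicator 1 ω} = {ω | K + 1 ≤ f ω} ∪ (A ∩ {ω | K ≤ f ω}) := by
      ext ω
      by_cases h : ω ∈ A <;> simp [h]
      omega
    have hi : {ω | K + 1 ≤ f ω} ∩ (A ∩ {ω | K ≤ f ω}) = A ∩ {ω | K + 1 ≤ f ω} := by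
      ext ω
      simp only [mem_inter_iff, mem_ofPred_eq]
      constructor
      · tauto
      · rintro ⟨h1, h2⟩
        exact ⟨h2, h1, by omega⟩
    have key := hs (hC (K + 1)) (hA.inter (hC K))
    rw [hi, ← hu] at key
    simp only [levelSum, Finset.sum_range_succ] at ih ⊢
    linarith

theorem levelSum_add_min_le (hw : IsCapacity w) (hs : IsSubmodular w) (K : ℕ) {f g : Ω → ℕ}
    (hf : Measurable f) (hg : Measurable g) (m : ℕ) :
    levelSum w K (fun ω => f ω + min (g ω) m) ≤ levelSum w K f + levelSum w m g := by
  induction m with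
  | zero => simp [levelSum]
  | succ m ih =>
    have hA : MeasurableSet {ω | m + 1 ≤ g ω} := measurableSet_le measurable_const hg
    have h := levelSum_add_indicator_le hw hs K
      (f := fun ω => f ω + min (g ω) m) (hf.add (hg.min measurable_const)) hA
    have heq : (fun ω => f ω + min (g ω) m + {ω | m + 1 ≤ g ω}.indicator 1 ω)
        = fun ω => f ω + min (g ω) (m + 1) := by
      funext ω
      by_cases h : m + 1 ≤ g ω
      · have h' : m ≤ g ω := by omega
        simp [Nat.lt_of_succ_le h, h', add_assoc]
      · have h' : g ω ≤ m := by omega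
        simp [h', h'.trans (Nat.le_succ m)]
    rw [heq] at h
    simp only [levelSum, Finset.sum_range_succ] at ih h ⊢
    linarith

theorem levelSum_add_le (hw : IsCapacity w) (hs : IsSubmodular w) (K : ℕ) {f g : Ω → ℕ}
    (hf : Measurable f) (hg : Measurable g) (hgK : ∀ ω, g ω ≤ K) :
    levelSum w K (fun ω => f ω + g ω) ≤ levelSum w K f + levelSum w K g := by
  simpa only [min_eq_left (hgK _)] using levelSum_add_min_le hw hs K hf hg K

end LevelSum

section Choquet

variable {Ω : Type*} [MeasurableSpace Ω] {w : Set Ω → ℝ}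

theorem IsCapacity.antitone_upperLevel (hw : IsCapacity w) {X : Ω → ℝ} (hX : Measurable X) :
    Antitone fun x : ℝ => w {ω | x ≤ X ω} := fun _ _ hxy =>
  hw.2.2 (measurableSet_le measurable_const hX) (measurableSet_le measurable_const hX)
    fun _ hω => le_trans hxy hω

/-- The Choquet integral as a single integral over an interval containing the range. -/
theorem choquetIntegral_eq (hw : IsCapacity w) {X : Ω → ℝ} (hX : Measurable X) {a b : ℝ}
    (ha : ∀ ω, a ≤ X ω) (hb : ∀ ω, X ω ≤ b) :
    choquetIntegral w X = a + ∫ x in a..b, w {ω | x ≤ X ω} := by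
  obtain ⟨ω₀⟩ := hw.nonempty
  have hab : a ≤ b := (ha ω₀).trans (hb ω₀)
  have hint : ∀ c d : ℝ, IntervalIntegrable (fun x : ℝ => w {ω | x ≤ X ω}) volume c d :=
    fun c d => (hw.antitone_upperLevel hX).intervalIntegrable
  have hone : ∀ x ≤ a, w {ω | x ≤ X ω} = 1 := fun x hx => by
    rw [← hw.2.1]
    congr 1
    exact eq_univ_of_forall fun ω => hx.trans (ha ω)
  have hzero : ∀ x, b < x → w {ω | x ≤ X ω} = 0 := fun x hx => by
    rw [← hw.1]
    congr 1
    exact eq_empty_of_forall_notMem fun ω hω => absurd (hb ω) (not_le.2 (hx.trans_le hω))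
  have hA : min a 0 ≤ 0 := min_le_right _ _
  have hB : 0 ≤ max b 0 := le_max_right _ _
  have hneg : ∫ x in Iio (0 : ℝ), (w {ω | x ≤ X ω} - 1)
      = (∫ x in (min a 0)..0, w {ω | x ≤ X ω}) + min a 0 := by
    have h1 : ∫ x in Iio (0 : ℝ), (w {ω | x ≤ X ω} - 1)
        = ∫ x in (min a 0)..0, (w {ω | x ≤ X ω} - 1) := by
      rw [← integral_Iic_eq_integral_Iio, intervalIntegral.integral_of_le hA]
      refine setIntegral_eq_of_subset_of_forall_sdiff_eq_zero measurableSet_Iic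
        Ioc_subset_Iic_self fun x hx => ?_
      have hx' : x ≤ min a 0 := by
        by_contra h
        exact hx.2 ⟨not_le.1 h, hx.1⟩
      rw [hone x (hx'.trans (min_le_left _ _)), sub_self]
    rw [h1, intervalIntegral.integral_sub (hint _ _) intervalIntegrable_const]
    simp
  have hpos : ∫ x in Ioi (0 : ℝ), w {ω | x ≤ X ω}
      = ∫ x in (0 : ℝ)..(max b 0), w {ω | x ≤ X ω} := by
    rw [intervalIntegral.integral_of_le hB]
    refine setIntegral_eq_of_subset_of_forall_sdiff_eq_zero measurableSet_Ioi
      Ioc_subset_Ioi_self fun x hx => ?_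
    refine hzero x ((le_max_left b 0).trans_lt ?_)
    by_contra h
    exact hx.2 ⟨hx.1, not_lt.1 h⟩
  have hl : ∫ x in (min a 0)..a, w {ω | x ≤ X ω} = a - min a 0 := by
    rw [intervalIntegral.integral_of_le (min_le_left _ _),
      setIntegral_congr_fun (g := fun _ => (1 : ℝ)) measurableSet_Ioc fun x hx => hone x hx.2,
      ← intervalIntegral.integral_of_le (min_le_left _ _)]
    simp
  have hr : ∫ x in b..(max b 0), w {ω | x ≤ X ω} = 0 := by
    rw [intervalIntegral.integral_of_le (le_max_left _ _),
      setIntegral_congr_fun (g := fun _ => (0 : ℝ)) measurableSet_Ioc fun x hx => hzero x hx.1]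
    simp
  have hadd := intervalIntegral.integral_add_adjacent_intervals
    (hint (min a 0) 0) (hint 0 (max b 0))
  have hadd₁ := intervalIntegral.integral_add_adjacent_intervals
    (hint (min a 0) a) (hint a (max b 0))
  have hadd₂ := intervalIntegral.integral_add_adjacent_intervals
    (hint a b) (hint b (max b 0))
  rw [choquetIntegral, hneg, hpos]
  linarith

/-- The bounded measurable real functions. -/
def boundedMeasurable (Ω : Type*) [MeasurableSpace Ω] : Submodule ℝ (Ω → ℝ) where
  carrier := {X | Measurable X ∧ ∃ M : ℝ, ∀ ω, |X ω| ≤ M}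
  add_mem' := by
    rintro X Y ⟨hX, M, hM⟩ ⟨hY, M', hM'⟩
    exact ⟨hX.add hY, M + M', fun ω => (abs_add_le _ _).trans (add_le_add (hM ω) (hM' ω))⟩
  zero_mem' := ⟨measurable_const, 0, fun ω => by simp⟩
  smul_mem' := by
    rintro c X ⟨hX, M, hM⟩
    refine ⟨hX.const_smul c, |c| * M, fun ω => ?_⟩
    rw [Pi.smul_apply, smul_eq_mul, abs_mul]
    exact mul_le_mul_of_nonneg_left (hM ω) (abs_nonneg c)

theorem mem_boundedMeasurable {X : Ω → ℝ} :
    X ∈ boundedMeasurable Ω ↔ Measurable X ∧ ∃ M : ℝ, ∀ ω, |X ω| ≤ M := Iff.rfl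

theorem const_mem_boundedMeasurable (c : ℝ) : (fun _ => c) ∈ boundedMeasurable Ω :=
  ⟨measurable_const, |c|, fun _ => le_rfl⟩

theorem indicator_mem_boundedMeasurable {A : Set Ω} (hA : MeasurableSet A) :
    A.indicator (1 : Ω → ℝ) ∈ boundedMeasurable Ω := by
  refine ⟨measurable_one.indicator hA, 1, fun ω => ?_⟩
  by_cases h : ω ∈ A <;> simp [h]

theorem choquetIntegral_mono (hw : IsCapacity w) {X Y : Ω → ℝ} (hX : X ∈ boundedMeasurable Ω)
    (hY : Y ∈ boundedMeasurable Ω) (hXY : ∀ ω, X ω ≤ Y ω) :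
    choquetIntegral w X ≤ choquetIntegral w Y := by
  obtain ⟨hX, M, hM⟩ := hX
  obtain ⟨hY, M', hM'⟩ := hY
  obtain ⟨ω₀⟩ := hw.nonempty
  have hX1 := fun ω => (abs_le.1 (hM ω)).1
  have hY2 := fun ω => (abs_le.1 (hM' ω)).2
  rw [choquetIntegral_eq hw hX hX1 fun ω => (hXY ω).trans (hY2 ω),
    choquetIntegral_eq hw hY (fun ω => (hX1 ω).trans (hXY ω)) hY2]
  refine add_le_add_right (intervalIntegral.integral_mono
    ((hX1 ω₀).trans ((hXY ω₀).trans (hY2 ω₀)))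
    (hw.antitone_upperLevel hX).intervalIntegrable (hw.antitone_upperLevel hY).intervalIntegrable
    fun x => ?_) _
  exact hw.2.2 (measurableSet_le measurable_const hX) (measurableSet_le measurable_const hY)
    fun ω hω => le_trans hω (hXY ω)

theorem choquetIntegral_mono_capacity {v : Set Ω → ℝ} (hv : IsCapacity v) (hw : IsCapacity w)
    (hvw : ∀ A, MeasurableSet A → v A ≤ w A) {X : Ω → ℝ} (hX : X ∈ boundedMeasurable Ω) :
    choquetIntegral v X ≤ choquetIntegral w X := by
  obtain ⟨hX, M, hM⟩ := hX
  obtain ⟨ω₀⟩ := hw.nonempty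
  have hX1 := fun ω => (abs_le.1 (hM ω)).1
  have hX2 := fun ω => (abs_le.1 (hM ω)).2
  rw [choquetIntegral_eq hv hX hX1 hX2, choquetIntegral_eq hw hX hX1 hX2]
  exact add_le_add_right (intervalIntegral.integral_mono ((hX1 ω₀).trans (hX2 ω₀))
    (hv.antitone_upperLevel hX).intervalIntegrable (hw.antitone_upperLevel hX).intervalIntegrable
    fun x => hvw _ (measurableSet_le measurable_const hX)) _

theorem choquetIntegral_const (hw : IsCapacity w) (c : ℝ) :
    choquetIntegral w (fun _ => c) = c := by
  simp [choquetIntegral_eq hw measurable_const (fun _ => le_rfl) (fun _ => le_rfl)]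

theorem choquetIntegral_zero (hw : IsCapacity w) : choquetIntegral w 0 = 0 :=
  choquetIntegral_const hw 0

theorem choquetIntegral_indicator (hw : IsCapacity w) {A : Set Ω} (hA : MeasurableSet A) :
    choquetIntegral w (A.indicator 1) = w A := by
  rw [choquetIntegral_eq hw (measurable_one.indicator hA) (a := 0) (b := 1), zero_add,
    intervalIntegral.integral_of_le zero_le_one,
    setIntegral_congr_fun (g := fun _ => w A) measurableSet_Ioc]
  · simp
  · intro x hx
    change w _ = w A
    congr 1
    ext ω
    by_cases h : ω ∈ A <;> simp [h, hx.1, hx.2]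
  · intro ω
    by_cases h : ω ∈ A <;> simp [h]
  · intro ω
    by_cases h : ω ∈ A <;> simp [h]

theorem choquetIntegral_add_const (hw : IsCapacity w) {X : Ω → ℝ}
    (hX : X ∈ boundedMeasurable Ω) (c : ℝ) :
    choquetIntegral w (fun ω => X ω + c) = choquetIntegral w X + c := by
  obtain ⟨hX, M, hM⟩ := hX
  have hX1 := fun ω => (abs_le.1 (hM ω)).1
  have hX2 := fun ω => (abs_le.1 (hM ω)).2
  rw [choquetIntegral_eq hw hX hX1 hX2, choquetIntegral_eq hw (hX.add_const c)
    (fun ω => add_le_add_left (hX1 ω) c) (fun ω => add_le_add_left (hX2 ω) c),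
    ← intervalIntegral.integral_comp_add_right]
  simp only [add_le_add_iff_right]
  ring

theorem choquetIntegral_smul (hw : IsCapacity w) {X : Ω → ℝ}
    (hX : X ∈ boundedMeasurable Ω) {c : ℝ} (hc : 0 < c) :
    choquetIntegral w (c • X) = c * choquetIntegral w X := by
  obtain ⟨hX, M, hM⟩ := hX
  have hX1 := fun ω => (abs_le.1 (hM ω)).1
  have hX2 := fun ω => (abs_le.1 (hM ω)).2
  rw [choquetIntegral_eq hw hX hX1 hX2, choquetIntegral_eq hw (hX.const_smul c)
    (fun ω => mul_le_mul_of_nonneg_left (hX1 ω) hc.le)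
    (fun ω => mul_le_mul_of_nonneg_left (hX2 ω) hc.le),
    ← intervalIntegral.mul_integral_comp_mul_left]
  simp only [Pi.smul_apply, smul_eq_mul, mul_le_mul_iff_right₀ hc]
  ring

theorem levelSum_floor_eq {Ω : Type*} {w : Set Ω → ℝ} {Z : Ω → ℝ} (K : ℕ) :
    levelSum w K (fun ω => ⌊Z ω⌋₊)
      = ∑ k ∈ Finset.range K, w {ω | ((k + 1 : ℕ) : ℝ) ≤ Z ω} := by
  simp only [levelSum, Nat.le_floor_iff' (Nat.succ_ne_zero _)]

theorem levelSum_floor_le_choquetIntegral (hw : IsCapacity w) {Z : Ω → ℝ} (hZ : Measurable Z)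
    {K : ℕ} (h0 : ∀ ω, 0 ≤ Z ω) (hK : ∀ ω, Z ω ≤ K) :
    levelSum w K (fun ω => ⌊Z ω⌋₊) ≤ choquetIntegral w Z := by
  rw [levelSum_floor_eq, choquetIntegral_eq hw hZ h0 hK]
  simpa using ((hw.antitone_upperLevel hZ).antitoneOn (Icc (0 : ℝ) (0 + K))).sum_le_integral

theorem choquetIntegral_le_levelSum_floor (hw : IsCapacity w) {Z : Ω → ℝ} (hZ : Measurable Z)
    {K : ℕ} (h0 : ∀ ω, 0 ≤ Z ω) (hK : ∀ ω, Z ω ≤ K) :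
    choquetIntegral w Z ≤ levelSum w K (fun ω => ⌊Z ω⌋₊) + 1 := by
  rw [levelSum_floor_eq, choquetIntegral_eq hw hZ h0 hK]
  have h := ((hw.antitone_upperLevel hZ).antitoneOn (Icc (0 : ℝ) (0 + K))).integral_le_sum
  have h1 := Finset.sum_range_succ (fun k : ℕ => w {ω | (k : ℝ) ≤ Z ω}) K
  rw [Finset.sum_range_succ'] at h1
  have h2 := hw.le_one (measurableSet_le (measurable_const (a := ((0 : ℕ) : ℝ))) hZ)
  have h3 := hw.nonneg (measurableSet_le (measurable_const (a := (K : ℝ))) hZ)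
  simp only [zero_add] at h ⊢
  linarith

theorem choquetIntegral_add_le_add_two (hw : IsCapacity w) (hs : IsSubmodular w) {Y Z : Ω → ℝ}
    (hYm : Measurable Y) (hZm : Measurable Z) {K : ℕ} (hY : ∀ ω, 0 ≤ Y ω) (hZ : ∀ ω, 0 ≤ Z ω)
    (hK : ∀ ω, Y ω + Z ω ≤ K) :
    choquetIntegral w (Y + Z) ≤ choquetIntegral w Y + choquetIntegral w Z + 2 := by
  have hYK : ∀ ω, Y ω ≤ K := fun ω => by linarith [hZ ω, hK ω]
  have hZK : ∀ ω, Z ω ≤ K := fun ω => by linarith [hY ω, hK ω]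
  have hfY : Measurable fun ω => ⌊Y ω⌋₊ := hYm.nat_floor
  have hfZ : Measurable fun ω => ⌊Z ω⌋₊ := hZm.nat_floor
  have h1 := choquetIntegral_le_levelSum_floor hw (hYm.add hZm)
    (fun ω => add_nonneg (hY ω) (hZ ω)) hK
  have h2 := levelSum_mono hw K (hYm.add hZm).nat_floor
    (g := fun ω => ⌊Y ω⌋₊ + ⌊Z ω⌋₊ + (univ : Set Ω).indicator 1 ω) (by simp; fun_prop) fun ω => by
      simp only [indicator_univ, Pi.one_apply, ← Nat.lt_succ_iff, Pi.add_apply]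
      rw [Nat.floor_lt (add_nonneg (hY ω) (hZ ω))]
      push_cast
      linarith [Nat.lt_floor_add_one (Y ω), Nat.lt_floor_add_one (Z ω)]
  have h3 := levelSum_add_indicator_le hw hs K (f := fun ω => ⌊Y ω⌋₊ + ⌊Z ω⌋₊)
    (hfY.add hfZ) MeasurableSet.univ
  have h4 := levelSum_add_le hw hs K hfY hfZ fun ω => Nat.floor_le_of_le (hZK ω)
  have h5 := levelSum_floor_le_choquetIntegral hw hYm hY hYK
  have h6 := levelSum_floor_le_choquetIntegral hw hZm hZ hZK
  rw [hw.2.1] at h3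
  linarith

theorem le_of_forall_nat_mul_le_add {a b C : ℝ}
    (h : ∀ N : ℕ, 0 < N → (N : ℝ) * a ≤ N * b + C) : a ≤ b := by
  by_contra! hab
  obtain ⟨N, hN⟩ := exists_nat_gt (max (C / (a - b)) 0)
  have hN0 : 0 < N := by exact_mod_cast (le_max_right _ _).trans_lt hN
  have h1 := (div_lt_iff₀ (sub_pos.2 hab)).1 ((le_max_left _ _).trans_lt hN)
  linarith [h N hN0]

/-- The Choquet integral of a scaled and shifted function. -/
theorem choquetIntegral_smul_add_const (hw : IsCapacity w) {X : Ω → ℝ}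
    (hX : X ∈ boundedMeasurable Ω) {c : ℝ} (hc : 0 < c) (M : ℝ) :
    choquetIntegral w (fun ω => c * X ω + M) = c * choquetIntegral w X + M := by
  rw [← choquetIntegral_smul hw hX hc]
  exact choquetIntegral_add_const hw ((boundedMeasurable Ω).smul_mem c hX) M

theorem choquetIntegral_add_le (hw : IsCapacity w) (hs : IsSubmodular w) {X Y : Ω → ℝ}
    (hX : X ∈ boundedMeasurable Ω) (hY : Y ∈ boundedMeasurable Ω) :
    choquetIntegral w (X + Y) ≤ choquetIntegral w X + choquetIntegral w Y := by
  obtain ⟨MX, hMX⟩ := hX.2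
  obtain ⟨MY, hMY⟩ := hY.2
  refine le_of_forall_nat_mul_le_add (C := 2) fun N hN => ?_
  have hN' : (0 : ℝ) < N := by exact_mod_cast hN
  obtain ⟨K, hK⟩ := exists_nat_ge (N * (2 * MX + 2 * MY))
  have h := choquetIntegral_add_le_add_two hw hs (K := K)
    (Y := fun ω => N * X ω + N * MX) (Z := fun ω => N * Y ω + N * MY)
    ((hX.1.const_mul _).add_const _) ((hY.1.const_mul _).add_const _)
    (fun ω => by nlinarith [(abs_le.1 (hMX ω)).1])
    (fun ω => by nlinarith [(abs_le.1 (hMY ω)).1])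
    (fun ω => by nlinarith [(abs_le.1 (hMX ω)).2, (abs_le.1 (hMY ω)).2])
  have heq : ((fun ω => N * X ω + N * MX) + fun ω => N * Y ω + N * MY)
      = fun ω => (N : ℝ) * (X + Y) ω + (N * MX + N * MY) := by
    funext ω
    simp only [Pi.add_apply]
    ring
  rw [heq, choquetIntegral_smul_add_const hw ((boundedMeasurable Ω).add_mem hX hY) hN',
    choquetIntegral_smul_add_const hw hX hN', choquetIntegral_smul_add_const hw hY hN'] at h
  linarith

theorem choquetIntegral_sum_le (hw : IsCapacity w) (hs : IsSubmodular w) {ι : Type*}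
    (s : Finset ι) {Xs : ι → Ω → ℝ} (hXs : ∀ i, Xs i ∈ boundedMeasurable Ω) :
    choquetIntegral w (∑ i ∈ s, Xs i) ≤ ∑ i ∈ s, choquetIntegral w (Xs i) := by
  classical
  induction s using Finset.induction_on with
  | empty => simp [choquetIntegral_zero hw]
  | insert i s hi ih =>
    rw [Finset.sum_insert hi, Finset.sum_insert hi]
    linarith [choquetIntegral_add_le hw hs (hXs i)
      ((boundedMeasurable Ω).sum_mem fun j (_ : j ∈ s) => hXs j)]

end Choquet

section Duality

variable {Ω : Type*} [MeasurableSpace Ω]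

/-- A sublinear functional dominates a linear functional agreeing with it at a given point. -/
theorem exists_linearMap_le_sublinear_eq {E : Type*} [AddCommGroup E] [Module ℝ E] (N : E → ℝ)
    (hsmul : ∀ c : ℝ, 0 < c → ∀ x, N (c • x) = c * N x)
    (hadd : ∀ x y, N (x + y) ≤ N x + N y) (x : E) :
    ∃ L : E →ₗ[ℝ] ℝ, L x = N x ∧ ∀ y, L y ≤ N y := by
  have h0 : N 0 = 0 := by
    have h := hsmul 2 two_pos 0
    rw [smul_zero] at h
    linarith
  have H : ∀ c : ℝ, c • x = 0 → c • N x = 0 := fun c hc => by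
    rcases smul_eq_zero.1 hc with h | h <;> simp [h, h0]
  obtain ⟨L, hL, hLN⟩ := exists_extension_of_le_sublinear
    (LinearPMap.mkSpanSingleton' (σ := RingHom.id ℝ) x (N x) H) N hsmul hadd (by
      rintro ⟨y, hy⟩
      obtain ⟨c, rfl⟩ := Submodule.mem_span_singleton.1 hy
      rw [LinearPMap.mkSpanSingleton'_apply, RingHom.id_apply, smul_eq_mul]
      rcases lt_trichotomy c 0 with hc | rfl | hc
      · have h1 := hadd (c • x) ((-c) • x)
        rw [← add_smul, add_neg_cancel, zero_smul, h0, hsmul (-c) (neg_pos.2 hc)] at h1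
        change _ ≤ N (c • x)
        linarith
      · simp [h0]
      · exact (hsmul c hc x).ge)
  refine ⟨L, ?_, hLN⟩
  have hx : (1 : ℝ) • x ∈ (LinearPMap.mkSpanSingleton' (σ := RingHom.id ℝ) x (N x) H).domain :=
    Submodule.mem_span_singleton.2 ⟨1, rfl⟩
  have h := hL ⟨(1 : ℝ) • x, hx⟩
  rw [LinearPMap.mkSpanSingleton'_apply] at h
  simpa using h

/-- A monotone normalized linear functional `L` on bounded measurable functions is dominated by
the Choquet integral with respect to the set function `A ↦ L 1_A`. -/
theorem linearMap_le_choquetIntegral {L : (Ω → ℝ) →ₗ[ℝ] ℝ}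
    (hmono : ∀ Y ∈ boundedMeasurable Ω, (∀ ω, 0 ≤ Y ω) → 0 ≤ L Y) (hone : L 1 = 1)
    (hw : IsCapacity fun A : Set Ω => L (A.indicator 1))
    {X : Ω → ℝ} (hX : X ∈ boundedMeasurable Ω) :
    L X ≤ choquetIntegral (fun A : Set Ω => L (A.indicator 1)) X := by
  obtain ⟨M, hM⟩ := hX.2
  refine le_of_forall_nat_mul_le_add (C := 1) fun N hN => ?_
  have hN' : (0 : ℝ) < N := by exact_mod_cast hN
  obtain ⟨K, hK⟩ := exists_nat_ge (N * (2 * M))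
  let Z : Ω → ℝ := fun ω => N * X ω + N * M
  have hZm : Measurable Z := (hX.1.const_mul _).add_const _
  have hZ0 : ∀ ω, 0 ≤ Z ω := fun ω => by
    change 0 ≤ N * X ω + N * M
    nlinarith [(abs_le.1 (hM ω)).1]
  have hZK : ∀ ω, Z ω ≤ K := fun ω => by
    change N * X ω + N * M ≤ K
    nlinarith [(abs_le.1 (hM ω)).2]
  have hfloor : (fun ω => (⌊Z ω⌋₊ : ℝ))
      = ∑ k ∈ Finset.range K, {ω | k + 1 ≤ ⌊Z ω⌋₊}.indicator (1 : Ω → ℝ) := by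
    funext ω
    have hle : ⌊Z ω⌋₊ ≤ K := Nat.floor_le_of_le (hZK ω)
    rw [Finset.sum_apply]
    simp only [indicator_apply, mem_ofPred_eq, Pi.one_apply, Finset.sum_boole]
    congr 1
    have : {k ∈ Finset.range K | k + 1 ≤ ⌊Z ω⌋₊} = Finset.range ⌊Z ω⌋₊ := by
      ext k
      simp only [Finset.mem_filter, Finset.mem_range]
      omega
    rw [this, Finset.card_range]
  have hLfloor : L (fun ω => (⌊Z ω⌋₊ : ℝ))
      = levelSum (fun A : Set Ω => L (A.indicator 1)) K (fun ω => ⌊Z ω⌋₊) := by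
    rw [hfloor, map_sum]
    rfl
  have hnn := hmono ((fun ω => (⌊Z ω⌋₊ : ℝ)) + 1 - Z)
    ⟨((measurable_from_nat.comp hZm.nat_floor).add measurable_one).sub hZm, 1, fun ω => by
      simp only [Pi.sub_apply, Pi.add_apply, Pi.one_apply, abs_le]
      constructor <;> linarith [Nat.lt_floor_add_one (Z ω), Nat.floor_le (hZ0 ω)]⟩
    (fun ω => by
      simp only [Pi.sub_apply, Pi.add_apply, Pi.one_apply]
      linarith [Nat.lt_floor_add_one (Z ω)])
  have hZeq : Z = (N : ℝ) • X + (N * M : ℝ) • (1 : Ω → ℝ) := by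
    funext ω
    simp [Z]
  have hle := levelSum_floor_le_choquetIntegral hw hZm hZ0 hZK
  rw [choquetIntegral_smul_add_const hw hX hN'] at hle
  rw [map_sub, map_add, hone, hLfloor, hZeq, map_add, map_smul, map_smul, hone, ← hZeq,
    smul_eq_mul, smul_eq_mul] at hnn
  linarith

/-- The values `∑ i, ∫ X_i dw_i` over all allocations `(X_1, …, X_n)` of `X`. -/
def allocationValues {n : ℕ} (ws : Fin n → Set Ω → ℝ) (X : Ω → ℝ) : Set ℝ :=
  {y | ∃ Xs : Fin n → Ω → ℝ, (∀ i, Xs i ∈ boundedMeasurable Ω) ∧ ∑ i, Xs i = X ∧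
    y = ∑ i, choquetIntegral (ws i) (Xs i)}

variable {n : ℕ} {ws : Fin n → Set Ω → ℝ}

theorem choquetIntegral_le_of_mem_allocationValues (hws : ∀ i, IsCapacity (ws i))
    {w : Set Ω → ℝ} (hw : IsCapacity w) (hs : IsSubmodular w)
    (hle : ∀ A : Set Ω, MeasurableSet A → ∀ i, w A ≤ ws i A) {X : Ω → ℝ} {y : ℝ}
    (hy : y ∈ allocationValues ws X) : choquetIntegral w X ≤ y := by
  obtain ⟨Xs, hXs, rfl, rfl⟩ := hy
  exact (choquetIntegral_sum_le hw hs _ hXs).trans (Finset.sum_le_sum fun i _ =>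
    choquetIntegral_mono_capacity hw (hws i) (fun A hA => hle A hA i) (hXs i))

theorem choquetIntegral_mem_allocationValues (hws : ∀ i, IsCapacity (ws i)) {X : Ω → ℝ}
    (hX : X ∈ boundedMeasurable Ω) (i : Fin n) :
    choquetIntegral (ws i) X ∈ allocationValues ws X := by
  refine ⟨Pi.single i X, fun j => ?_, by simp, ?_⟩
  · rcases eq_or_ne j i with rfl | h
    · simpa using hX
    · simp [h]
  · rw [Finset.sum_eq_single i]
    · simp
    · intro j _ h
      simp [h, choquetIntegral_zero (hws j)]
    · simp

theorem smul_mem_allocationValues (hws : ∀ i, IsCapacity (ws i)) {X : Ω → ℝ} {y c : ℝ}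
    (hc : 0 < c) (hy : y ∈ allocationValues ws X) : c * y ∈ allocationValues ws (c • X) := by
  obtain ⟨Xs, hXs, rfl, rfl⟩ := hy
  refine ⟨fun i => c • Xs i, fun i => (boundedMeasurable Ω).smul_mem c (hXs i),
    Finset.smul_sum.symm, ?_⟩
  rw [Finset.mul_sum]
  exact Finset.sum_congr rfl fun i _ => (choquetIntegral_smul (hws i) (hXs i) hc).symm

theorem exists_mem_allocationValues_add_le (hws : ∀ i, IsCapacity (ws i) ∧ IsSubmodular (ws i))
    {X Y : Ω → ℝ} {x y : ℝ} (hx : x ∈ allocationValues ws X) (hy : y ∈ allocationValues ws Y) :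
    ∃ z ∈ allocationValues ws (X + Y), z ≤ x + y := by
  obtain ⟨Xs, hXs, rfl, rfl⟩ := hx
  obtain ⟨Ys, hYs, rfl, rfl⟩ := hy
  refine ⟨_, ⟨fun i => Xs i + Ys i, fun i => (boundedMeasurable Ω).add_mem (hXs i) (hYs i),
    Finset.sum_add_distrib, rfl⟩, ?_⟩
  rw [← Finset.sum_add_distrib]
  exact Finset.sum_le_sum fun i _ =>
    choquetIntegral_add_le (hws i).1 (hws i).2 (hXs i) (hYs i)

/-- The inf-convolution is represented at `X` by a linear functional dominated by every
`choquetIntegral (ws i)`. -/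
theorem exists_linearMap_eq_sInf_allocationValues (hn : 0 < n)
    (hws : ∀ i, IsCapacity (ws i) ∧ IsSubmodular (ws i))
    (hbdd : ∀ Y ∈ boundedMeasurable Ω, BddBelow (allocationValues ws Y))
    {X : Ω → ℝ} (hX : X ∈ boundedMeasurable Ω) :
    ∃ L : (Ω → ℝ) →ₗ[ℝ] ℝ, L X = sInf (allocationValues ws X) ∧
      ∀ Y ∈ boundedMeasurable Ω, ∀ i, L Y ≤ choquetIntegral (ws i) Y := by
  have hne : ∀ Y ∈ boundedMeasurable Ω, (allocationValues ws Y).Nonempty := fun Y hY =>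
    ⟨_, choquetIntegral_mem_allocationValues (fun i => (hws i).1) hY ⟨0, hn⟩⟩
  have hsmul_le : ∀ c : ℝ, 0 < c → ∀ Y ∈ boundedMeasurable Ω,
      sInf (allocationValues ws (c • Y)) ≤ c * sInf (allocationValues ws Y) := by
    intro c hc Y hY
    rw [← div_le_iff₀' hc]
    refine le_csInf (hne Y hY) fun y hy => ?_
    rw [div_le_iff₀' hc]
    exact csInf_le (hbdd _ ((boundedMeasurable Ω).smul_mem c hY))
      (smul_mem_allocationValues (fun i => (hws i).1) hc hy)
  obtain ⟨L, hLX, hL⟩ := exists_linearMap_le_sublinear_eq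
    (fun Y : boundedMeasurable Ω => sInf (allocationValues ws (Y : Ω → ℝ)))
    (by
      rintro c hc ⟨Y, hY⟩
      refine le_antisymm (hsmul_le c hc Y hY) ?_
      have h := hsmul_le c⁻¹ (inv_pos.2 hc) (c • Y) ((boundedMeasurable Ω).smul_mem c hY)
      rw [inv_smul_smul₀ hc.ne', ← div_eq_inv_mul, le_div_iff₀' hc] at h
      exact h)
    (by
      rintro ⟨Y, hY⟩ ⟨Z, hZ⟩
      change sInf (allocationValues ws (Y + Z)) ≤ _
      rw [← sub_le_iff_le_add]
      refine le_csInf (hne Y hY) fun y hy => ?_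
      rw [sub_le_comm]
      refine le_csInf (hne Z hZ) fun z hz => ?_
      obtain ⟨u, hu, hle⟩ := exists_mem_allocationValues_add_le hws hy hz
      have := csInf_le (hbdd _ ((boundedMeasurable Ω).add_mem hY hZ)) hu
      change sInf (allocationValues ws (Y + Z)) - y ≤ z
      linarith)
    ⟨X, hX⟩
  obtain ⟨L', hL'⟩ := LinearMap.exists_extend L
  have hL'' : ∀ Y (hY : Y ∈ boundedMeasurable Ω), L' Y = L ⟨Y, hY⟩ := fun Y hY => by
    rw [← hL']
    rfl
  refine ⟨L', (hL'' X hX).trans hLX, fun Y hY i => ?_⟩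
  rw [hL'' Y hY]
  exact (hL ⟨Y, hY⟩).trans (csInf_le (hbdd Y hY)
    (choquetIntegral_mem_allocationValues (fun i => (hws i).1) hY i))

/-- A linear functional dominated by a Choquet integral induces a submodular (indeed additive)
capacity whose Choquet integral dominates the functional. -/
theorem isCapacity_isSubmodular_of_linearMap_le {v : Set Ω → ℝ} (hv : IsCapacity v)
    {L : (Ω → ℝ) →ₗ[ℝ] ℝ} (hL : ∀ Y ∈ boundedMeasurable Ω, L Y ≤ choquetIntegral v Y) :
    IsCapacity (fun A : Set Ω => L (A.indicator 1)) ∧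
      IsSubmodular (fun A : Set Ω => L (A.indicator 1)) ∧
      ∀ X ∈ boundedMeasurable Ω,
        L X ≤ choquetIntegral (fun A : Set Ω => L (A.indicator 1)) X := by
  have hmono : ∀ Y ∈ boundedMeasurable Ω, (∀ ω, 0 ≤ Y ω) → 0 ≤ L Y := by
    intro Y hY h0
    have hY' := (boundedMeasurable Ω).neg_mem hY
    have h1 := hL _ hY'
    have h2 := choquetIntegral_mono hv hY' (boundedMeasurable Ω).zero_mem fun ω => by
      simpa using h0 ω
    rw [choquetIntegral_zero hv] at h2
    rw [map_neg] at h1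
    linarith
  have hone : L 1 = 1 := by
    have h1 := hL _ (const_mem_boundedMeasurable 1)
    have h2 := hL _ (const_mem_boundedMeasurable (-1))
    rw [choquetIntegral_const hv] at h1 h2
    have h3 : L (fun _ => -1) = -L 1 := by
      rw [← map_neg]
      rfl
    have h4 : L (fun _ => 1) = L 1 := rfl
    linarith
  have hcap : IsCapacity (fun A : Set Ω => L (A.indicator 1)) := by
    refine ⟨(congrArg L (indicator_empty' _)).trans (map_zero L), by simpa using hone,
      fun A B hA hB hAB => ?_⟩
    have h := hmono _ ((boundedMeasurable Ω).sub_mem (indicator_mem_boundedMeasurable hB)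
      (indicator_mem_boundedMeasurable hA)) fun ω => sub_nonneg.2
        (indicator_le_indicator_of_subset hAB (fun _ => zero_le_one) ω)
    rw [map_sub] at h
    exact sub_nonneg.1 h
  refine ⟨hcap, fun A B _ _ => ?_, fun X hX => linearMap_le_choquetIntegral hmono hone hcap hX⟩
  change L _ + L _ ≤ L _ + L _
  rw [← map_add, ← map_add, indicator_union_add_inter]

end Duality

/-- Inf-convolution of coherent Choquet integrals: for submodular capacities
`w_1, …, w_n` such that some submodular capacity is dominated by `min_i w_i`, the
inf-convolution of `I_{w_1}, …, I_{w_n}` at any bounded measurable `X` equals the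
supremum of `∫ X dw` over all submodular capacities `w ≤ min_i w_i`. -/
theorem infConvolution_submodular_choquet {Ω : Type*} [MeasurableSpace Ω]
    (n : ℕ) (hn : 0 < n)
    (ws : Fin n → Set Ω → ℝ)
    (hws : ∀ i, IsCapacity (ws i) ∧ IsSubmodular (ws i))
    (hex : ∃ w₀ : Set Ω → ℝ, IsCapacity w₀ ∧ IsSubmodular w₀ ∧
      ∀ A : Set Ω, MeasurableSet A → ∀ i, w₀ A ≤ ws i A)
    (X : Ω → ℝ) (hX : Measurable X) (hXb : ∃ M : ℝ, ∀ ω, |X ω| ≤ M) :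
    sInf {y : ℝ | ∃ Xs : Fin n → Ω → ℝ,
        (∀ i, Measurable (Xs i)) ∧ (∀ i, ∃ M : ℝ, ∀ ω, |Xs i ω| ≤ M) ∧
        (∀ ω, ∑ i, Xs i ω = X ω) ∧
        y = ∑ i, choquetIntegral (ws i) (Xs i)}
      = sSup {y : ℝ | ∃ w : Set Ω → ℝ, IsCapacity w ∧ IsSubmodular w ∧
          (∀ A : Set Ω, MeasurableSet A → ∀ i, w A ≤ ws i A) ∧
          y = choquetIntegral w X} := by
  have hmem : ∀ Y : Ω → ℝ, {y : ℝ | ∃ Xs : Fin n → Ω → ℝ,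
        (∀ i, Measurable (Xs i)) ∧ (∀ i, ∃ M : ℝ, ∀ ω, |Xs i ω| ≤ M) ∧
        (∀ ω, ∑ i, Xs i ω = Y ω) ∧
        y = ∑ i, choquetIntegral (ws i) (Xs i)} = allocationValues ws Y := by
    intro Y
    ext y
    simp only [allocationValues, mem_boundedMeasurable, forall_and, funext_iff, Finset.sum_apply,
      mem_ofPred_eq, and_assoc]
  rw [hmem X]
  have hXB : X ∈ boundedMeasurable Ω := ⟨hX, hXb⟩
  have hcap := fun i => (hws i).1
  obtain ⟨w₀, hw₀, hs₀, hle₀⟩ := hex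
  have hXv := choquetIntegral_mem_allocationValues hcap hXB ⟨0, hn⟩
  apply le_antisymm
  · obtain ⟨L, hLX, hL⟩ := exists_linearMap_eq_sInf_allocationValues hn hws
      (fun Y _ => ⟨_, fun y hy =>
        choquetIntegral_le_of_mem_allocationValues hcap hw₀ hs₀ hle₀ hy⟩) hXB
    obtain ⟨hw, hs, hLw⟩ := isCapacity_isSubmodular_of_linearMap_le (hcap ⟨0, hn⟩)
      fun Y hY => hL Y hY ⟨0, hn⟩
    rw [← hLX]
    refine (hLw X hXB).trans (le_csSup ⟨choquetIntegral (ws ⟨0, hn⟩) X, ?_⟩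
      ⟨_, hw, hs, fun A hA i => ?_, rfl⟩)
    · rintro _ ⟨w, hw, hs, hle, rfl⟩
      exact choquetIntegral_le_of_mem_allocationValues hcap hw hs hle hXv
    · rw [← choquetIntegral_indicator (hcap i) hA]
      exact hL _ (indicator_mem_boundedMeasurable hA) i
  · refine csSup_le ⟨_, w₀, hw₀, hs₀, hle₀, rfl⟩ ?_
    rintro _ ⟨w, hw, hs, hle, rfl⟩
    exact le_csInf ⟨_, hXv⟩ fun y hy =>
      choquetIntegral_le_of_mem_allocationValues hcap hw hs hle hy
end

section
/- Let (Ω, F) be a measurable space, let w be a submodular capacity on (Ω, F), and let α_1, …, α_n ∈ (0,1]. Then for every bounded F-measurable X : Ω → ℝ, the inf-convolution of the Choquet Expected Shortfalls ES^w_{α_1}, …, ES^w_{α_n} at X equals the Choquet Expected Shortfall at the largest level: inf{∑_{i=1}^n ES^w_{α_i}(X_i) : (X_1,…,X_n) is an allocation of X} = ES^w_{max(α_1,…,α_n)}(X). -/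
open MeasureTheory Set

/-- The Choquet Expected Shortfall `ES^w_α (X) = (1/α) ∫_0^α VaR^w_t (X) dt`. -/
noncomputable def choquetES {Ω : Type*} [MeasurableSpace Ω]
    (w : Set Ω → ℝ) (α : ℝ) (X : Ω → ℝ) : ℝ :=
  (1 / α) * ∫ t in (0 : ℝ)..α, VaRc w t X

section

variable {Ω : Type*} [MeasurableSpace Ω] {w : Set Ω → ℝ} {t : ℝ} {X Y : Ω → ℝ} {M : ℝ}

theorem mem_setOf_capacity_le (hw : IsCapacity w) (ht : 0 ≤ t) (hM : ∀ ω, |X ω| ≤ M)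
    {x : ℝ} (hx : M < x) : x ∈ {x : ℝ | w {ω | x ≤ X ω} ≤ t} := by
  have h : {ω | x ≤ X ω} = ∅ :=
    Set.eq_empty_of_forall_notMem fun ω hω =>
      absurd ((abs_le.1 (hM ω)).2) (not_le.2 (hx.trans_le hω))
  simpa [h, hw.1] using ht

theorem neg_le_of_capacity_le (hw : IsCapacity w) (ht : t < 1) (hM : ∀ ω, |X ω| ≤ M)
    {x : ℝ} (hx : x ∈ {x : ℝ | w {ω | x ≤ X ω} ≤ t}) : -M ≤ x := by
  by_contra! h
  have h' : {ω | x ≤ X ω} = Set.univ :=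
    Set.eq_univ_of_forall fun ω => h.le.trans (abs_le.1 (hM ω)).1
  rw [mem_ofPred_eq, h', hw.2.1] at hx
  exact absurd hx (not_le.2 ht)

theorem bddBelow_setOf_capacity_le (hw : IsCapacity w) (ht : t < 1) (hM : ∀ ω, |X ω| ≤ M) :
    BddBelow {x : ℝ | w {ω | x ≤ X ω} ≤ t} :=
  ⟨-M, fun _ hx => neg_le_of_capacity_le hw ht hM hx⟩

theorem abs_VaRc_le (hw : IsCapacity w) (ht : t ∈ Ico (0 : ℝ) 1) (hM : ∀ ω, |X ω| ≤ M) :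
    |VaRc w t X| ≤ M := by
  refine abs_le.2 ⟨le_csInf ⟨M + 1, mem_setOf_capacity_le hw ht.1 hM (lt_add_one M)⟩
    fun x hx => neg_le_of_capacity_le hw ht.2 hM hx, ?_⟩
  refine le_of_forall_gt_imp_ge_of_dense fun x hx => ?_
  exact csInf_le (bddBelow_setOf_capacity_le hw ht.2 hM) (mem_setOf_capacity_le hw ht.1 hM hx)

theorem VaRc_mono (hw : IsCapacity w) (ht : t ∈ Ico (0 : ℝ) 1) (hX : Measurable X)
    (hY : Measurable Y) (hXb : ∃ M : ℝ, ∀ ω, |X ω| ≤ M) (hYb : ∃ M : ℝ, ∀ ω, |Y ω| ≤ M)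
    (h : ∀ ω, X ω ≤ Y ω) : VaRc w t X ≤ VaRc w t Y := by
  obtain ⟨M, hM⟩ := hXb
  obtain ⟨K, hK⟩ := hYb
  refine csInf_le_csInf (bddBelow_setOf_capacity_le hw ht.2 hM)
    ⟨K + 1, mem_setOf_capacity_le hw ht.1 hK (lt_add_one K)⟩ fun x hx => ?_
  exact (hw.2.2 (measurableSet_le measurable_const hX) (measurableSet_le measurable_const hY)
    fun ω hω => le_trans hω (h ω)).trans hx

theorem VaRc_antitoneOn (hw : IsCapacity w) (hXb : ∃ M : ℝ, ∀ ω, |X ω| ≤ M) :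
    AntitoneOn (fun t => VaRc w t X) (Ico 0 1) := by
  obtain ⟨M, hM⟩ := hXb
  intro s hs t ht hst
  exact csInf_le_csInf (bddBelow_setOf_capacity_le hw ht.2 hM)
    ⟨M + 1, mem_setOf_capacity_le hw hs.1 hM (lt_add_one M)⟩ fun x hx => le_trans hx hst

theorem VaRc_affine (hw : IsCapacity w) (ht : t ∈ Ico (0 : ℝ) 1)
    (hXb : ∃ M : ℝ, ∀ ω, |X ω| ≤ M) {a : ℝ} (ha : 0 < a) (b : ℝ) :
    VaRc w t (fun ω => a * X ω + b) = a * VaRc w t X + b := by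
  obtain ⟨M, hM⟩ := hXb
  have h := ((OrderIso.mulLeft₀ a ha).trans (OrderIso.addRight b)).map_csInf'
    ⟨M + 1, mem_setOf_capacity_le hw ht.1 hM (lt_add_one M)⟩
    (bddBelow_setOf_capacity_le hw ht.2 hM)
  simp only [OrderIso.trans_apply, OrderIso.mulLeft₀_apply, OrderIso.addRight_apply] at h
  rw [VaRc, VaRc, h]
  congr 1
  ext y
  simp only [mem_ofPred_eq, mem_image, OrderIso.trans_apply, OrderIso.mulLeft₀_apply,
    OrderIso.addRight_apply]
  have key : ∀ x : ℝ, {ω | a * x + b ≤ a * X ω + b} = {ω | x ≤ X ω} := fun x => by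
    ext ω; simp [ha]
  constructor
  · intro hy
    have hy' : a * ((y - b) / a) + b = y := by field_simp; ring
    exact ⟨(y - b) / a, by rwa [← key, hy'], hy'⟩
  · rintro ⟨x, hx, rfl⟩
    rwa [key]

theorem intervalIntegrable_VaRc (hw : IsCapacity w) (hXb : ∃ M : ℝ, ∀ ω, |X ω| ≤ M) {a : ℝ}
    (ha : a ∈ Ioc (0 : ℝ) 1) :
    IntervalIntegrable (fun t => VaRc w t X) volume 0 a := by
  rw [intervalIntegrable_iff_integrableOn_Ioo_of_le ha.1.le]
  have hsub : Ioo 0 a ⊆ Ico (0 : ℝ) 1 := fun t ht => ⟨ht.1.le, ht.2.trans_le ha.2⟩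
  have hmeas := aemeasurable_restrict_of_antitoneOn (μ := volume) measurableSet_Ioo
    ((VaRc_antitoneOn hw hXb).mono hsub)
  obtain ⟨M, hM⟩ := hXb
  refine Integrable.of_bound hmeas.aestronglyMeasurable M ?_
  filter_upwards [ae_restrict_mem measurableSet_Ioo] with t ht
  exact abs_VaRc_le hw (hsub ht) hM

theorem integral_VaRc_mono (hw : IsCapacity w) (hX : Measurable X)
    (hY : Measurable Y) (hXb : ∃ M : ℝ, ∀ ω, |X ω| ≤ M) (hYb : ∃ M : ℝ, ∀ ω, |Y ω| ≤ M)
    (h : ∀ ω, X ω ≤ Y ω) {a : ℝ} (ha : a ∈ Ioc (0 : ℝ) 1) :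
    ∫ t in (0 : ℝ)..a, VaRc w t X ≤ ∫ t in (0 : ℝ)..a, VaRc w t Y :=
  intervalIntegral.integral_mono_on_of_le_Ioo ha.1.le (intervalIntegrable_VaRc hw hXb ha)
    (intervalIntegrable_VaRc hw hYb ha) fun _ ht =>
      VaRc_mono hw ⟨ht.1.le, ht.2.trans_le ha.2⟩ hX hY hXb hYb h

theorem integral_congr_Ioo {f g : ℝ → ℝ} {a : ℝ} (ha : 0 ≤ a)
    (h : ∀ t ∈ Ioo 0 a, f t = g t) : ∫ t in (0 : ℝ)..a, f t = ∫ t in (0 : ℝ)..a, g t := by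
  simp only [intervalIntegral.integral_of_le ha, integral_Ioc_eq_integral_Ioo]
  exact setIntegral_congr_fun measurableSet_Ioo h

theorem integral_VaRc_affine (hw : IsCapacity w)
    (hXb : ∃ M : ℝ, ∀ ω, |X ω| ≤ M) {c : ℝ} (hc : 0 < c) (b : ℝ)
    {a : ℝ} (ha : a ∈ Ioc (0 : ℝ) 1) :
    ∫ t in (0 : ℝ)..a, VaRc w t (fun ω => c * X ω + b)
      = c * (∫ t in (0 : ℝ)..a, VaRc w t X) + b * a := by
  rw [integral_congr_Ioo (g := fun t => c * VaRc w t X + b) ha.1.le fun t ht =>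
      VaRc_affine hw ⟨ht.1.le, ht.2.trans_le ha.2⟩ hXb hc b,
    intervalIntegral.integral_add ((intervalIntegrable_VaRc hw hXb ha).const_mul c)
      intervalIntegrable_const,
    intervalIntegral.integral_const_mul, intervalIntegral.integral_const]
  simp [mul_comm]

theorem choquetES_antitone (hw : IsCapacity w) (hXb : ∃ M : ℝ, ∀ ω, |X ω| ≤ M) {a b : ℝ}
    (ha : a ∈ Ioc (0 : ℝ) 1) (hb : b ∈ Ioc (0 : ℝ) 1) (hab : a ≤ b) :
    choquetES w b X ≤ choquetES w a X := by
  have key : ∀ {c : ℝ}, c ∈ Ioc (0 : ℝ) 1 →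
      choquetES w c X = ∫ s in (0 : ℝ)..1, VaRc w (c * s) X ∧
      IntervalIntegrable (fun s => VaRc w (c * s) X) volume 0 1 := by
    intro c hc
    constructor
    · have := intervalIntegral.integral_comp_mul_left (a := 0) (b := 1)
        (fun t => VaRc w t X) hc.1.ne'
      rw [this, choquetES]
      simp
    · have := (intervalIntegrable_VaRc hw hXb hc).comp_mul_left (c := c)
      simpa [hc.1.ne'] using this
  rw [(key ha).1, (key hb).1]
  refine intervalIntegral.integral_mono_on_of_le_Ioo zero_le_one (key hb).2 (key ha).2
    fun s hs => VaRc_antitoneOn hw hXb ?_ ?_ (mul_le_mul_of_nonneg_right hab hs.1.le)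
  · exact ⟨mul_nonneg ha.1.le hs.1.le, (mul_le_of_le_one_left hs.1.le ha.2).trans_lt hs.2⟩
  · exact ⟨mul_nonneg hb.1.le hs.1.le, (mul_le_of_le_one_left hs.1.le hb.2).trans_lt hs.2⟩

theorem VaRc_natCast (hw : IsCapacity w) (ht : t ∈ Ico (0 : ℝ) 1) {f : Ω → ℕ} (hf : Measurable f)
    {m : ℕ} (hm : ∀ ω, f ω ≤ m) :
    VaRc w t (fun ω => (f ω : ℝ))
      = ∑ k ∈ Finset.range m, (Iio (w {ω | k + 1 ≤ f ω})).indicator (fun _ => (1 : ℝ)) t := by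
  have hlev : ∀ k : ℕ, MeasurableSet {ω | k ≤ f ω} := fun k =>
    measurableSet_le measurable_const hf
  have hlevR : ∀ x : ℝ, MeasurableSet {ω | x ≤ (f ω : ℝ)} := fun x =>
    measurableSet_le measurable_const (measurable_from_nat.comp hf)
  have hend : w {ω | m + 1 ≤ f ω} ≤ t := by
    have : {ω | m + 1 ≤ f ω} = ∅ :=
      Set.eq_empty_of_forall_notMem fun ω hω => absurd (hm ω) (not_le.2 hω)
    rw [this, hw.1]
    exact ht.1
  classical
  have hex : ∃ j, w {ω | j + 1 ≤ f ω} ≤ t := ⟨m, hend⟩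
  obtain ⟨j, hj, hmin⟩ : ∃ j, w {ω | j + 1 ≤ f ω} ≤ t ∧ ∀ k < j, t < w {ω | k + 1 ≤ f ω} :=
    ⟨Nat.find hex, Nat.find_spec hex, fun k hk => not_le.1 (Nat.find_min hex hk)⟩
  have hjm : j ≤ m := by
    by_contra! h
    exact absurd hend (not_le.2 (hmin m h))
  have hset : {x : ℝ | w {ω | x ≤ (f ω : ℝ)} ≤ t} = Ioi (j : ℝ) := by
    ext x
    simp only [mem_ofPred_eq, mem_Ioi]
    constructor
    · intro hx
      by_contra! hxj
      have hle : w {ω | j ≤ f ω} ≤ t :=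
        (hw.2.2 (hlev j) (hlevR x) fun ω hω =>
          hxj.trans (Nat.cast_le.2 (show j ≤ f ω from hω))).trans hx
      rcases j with _ | p
      · simp only [Nat.zero_le, ofPred_true, hw.2.1] at hle
        exact absurd hle (not_le.2 ht.2)
      · exact absurd hle (not_le.2 (hmin p p.lt_succ_self))
    · intro hx
      refine (hw.2.2 (hlevR x) (hlev (j + 1)) fun ω hω => ?_).trans hj
      exact Nat.cast_lt.1 (hx.trans_le hω)
  have hfilter : ∀ k, (Iio (w {ω | k + 1 ≤ f ω})).indicator (fun _ => (1 : ℝ)) t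
      = if k < j then 1 else 0 := by
    intro k
    rw [indicator_apply]
    refine if_congr ⟨fun h => ?_, hmin k⟩ rfl rfl
    by_contra! hjk
    refine absurd ((hw.2.2 (hlev (k + 1)) (hlev (j + 1)) fun ω hω => ?_).trans hj) (not_le.2 h)
    exact le_trans (Nat.succ_le_succ hjk) hω
  rw [VaRc, hset, csInf_Ioi, Finset.sum_congr rfl fun k _ => hfilter k, ← Finset.sum_filter]
  have : (Finset.range m).filter (· < j) = Finset.range j := by
    ext k; simp; omega
  simp [this]

theorem setIntegral_indicator_Iio {a c : ℝ} (ha : 0 ≤ a) (hc : 0 ≤ c) :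
    ∫ t in Ioo 0 a, (Iio c).indicator (fun _ => (1 : ℝ)) t = min c a := by
  rw [integral_indicator measurableSet_Iio, Measure.restrict_restrict measurableSet_Iio,
    inter_comm, Ioo_inter_Iio]
  simp [ha, hc, min_comm]

theorem integral_VaRc_natCast (hw : IsCapacity w) {f : Ω → ℕ} (hf : Measurable f)
    {m : ℕ} (hm : ∀ ω, f ω ≤ m) {a : ℝ} (ha : a ∈ Ioc (0 : ℝ) 1) :
    ∫ t in (0 : ℝ)..a, VaRc w t (fun ω => (f ω : ℝ))
      = ∑ k ∈ Finset.range m, min (w {ω | k + 1 ≤ f ω}) a := by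
  have hnn : ∀ k, 0 ≤ w {ω | k + 1 ≤ f ω} := fun k =>
    hw.1.symm.le.trans (hw.2.2 .empty (measurableSet_le measurable_const hf) (empty_subset _))
  rw [integral_congr_Ioo ha.1.le fun t ht =>
      VaRc_natCast hw ⟨ht.1.le, ht.2.trans_le ha.2⟩ hf hm,
    intervalIntegral.integral_of_le ha.1.le, integral_Ioc_eq_integral_Ioo, integral_finsetSum]
  · exact Finset.sum_congr rfl fun k _ => setIntegral_indicator_Iio ha.1.le (hnn k)
  · exact fun k _ => (integrable_const (1 : ℝ)).indicator measurableSet_Iio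

/-- Truncating a submodular monotone set function at a constant keeps it submodular. -/
theorem min_const_submodular (hw : IsCapacity w) (hsub : IsSubmodular w) (a : ℝ) :
    IsSubmodular fun A => min (w A) a := by
  intro A B hA hB
  have h := hsub hA hB
  have h1 := hw.2.2 hA (hA.union hB) subset_union_left
  have h2 := hw.2.2 hB (hA.union hB) subset_union_right
  have h3 := hw.2.2 (hA.inter hB) hA inter_subset_left
  have h4 := hw.2.2 (hA.inter hB) hB inter_subset_right
  dsimp only
  rcases min_cases (w A) a with ⟨e1, _⟩ | ⟨e1, _⟩ <;>
  rcases min_cases (w B) a with ⟨e2, _⟩ | ⟨e2, _⟩ <;>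
  rcases min_cases (w (A ∪ B)) a with ⟨e3, _⟩ | ⟨e3, _⟩ <;>
  rcases min_cases (w (A ∩ B)) a with ⟨e4, _⟩ | ⟨e4, _⟩ <;>
  rw [e1, e2, e3, e4] <;> linarith

theorem sum_levels_add_indicator_le {v : Set Ω → ℝ} (hv : IsSubmodular v)
    (hnn : ∀ A, MeasurableSet A → 0 ≤ v A) {f : Ω → ℕ} (hf : Measurable f)
    {B : Set Ω} (hB : MeasurableSet B) (m : ℕ) :
    ∑ k ∈ Finset.range m, v {ω | k + 1 ≤ f ω + B.indicator 1 ω}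
      ≤ (∑ k ∈ Finset.range m, v {ω | k + 1 ≤ f ω}) + v B := by
  have hlev : ∀ k : ℕ, MeasurableSet {ω | k ≤ f ω} := fun k =>
    measurableSet_le measurable_const hf
  suffices h : ∑ k ∈ Finset.range m, v {ω | k + 1 ≤ f ω + B.indicator 1 ω}
      + v (B ∩ {ω | m ≤ f ω}) ≤ (∑ k ∈ Finset.range m, v {ω | k + 1 ≤ f ω}) + v B by
    linarith [hnn _ (hB.inter (hlev m))]
  induction m with
  | zero => simp
  | succ m ih =>
    have h := hv (hlev (m + 1)) (hB.inter (hlev m))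
    have e1 : {ω | m + 1 ≤ f ω} ∪ B ∩ {ω | m ≤ f ω}
        = {ω | m + 1 ≤ f ω + B.indicator 1 ω} := by
      ext ω
      by_cases hω : ω ∈ B <;> simp [hω]
      omega
    have e2 : {ω | m + 1 ≤ f ω} ∩ (B ∩ {ω | m ≤ f ω}) = B ∩ {ω | m + 1 ≤ f ω} := by
      ext ω
      simp only [mem_inter_iff, mem_ofPred_eq]
      constructor
      · exact fun h => ⟨h.2.1, h.1⟩
      · exact fun h => ⟨h.2, h.1, by omega⟩
    rw [e1, e2] at h
    rw [Finset.sum_range_succ, Finset.sum_range_succ]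
    linarith

theorem sum_levels_add_le {v : Set Ω → ℝ} (hv : IsSubmodular v)
    (hnn : ∀ A, MeasurableSet A → 0 ≤ v A) {f g : Ω → ℕ} (hf : Measurable f)
    (hg : Measurable g) (m p : ℕ) (hp : ∀ ω, g ω ≤ p) :
    ∑ k ∈ Finset.range m, v {ω | k + 1 ≤ f ω + g ω}
      ≤ ∑ k ∈ Finset.range m, v {ω | k + 1 ≤ f ω}
        + ∑ k ∈ Finset.range p, v {ω | k + 1 ≤ g ω} := by
  suffices h : ∀ q : ℕ, ∑ k ∈ Finset.range m, v {ω | k + 1 ≤ f ω + min (g ω) q}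
      ≤ ∑ k ∈ Finset.range m, v {ω | k + 1 ≤ f ω}
        + ∑ k ∈ Finset.range q, v {ω | k + 1 ≤ g ω} by
    simpa [hp] using h p
  intro q
  induction q with
  | zero => simp
  | succ q ih =>
    have h := sum_levels_add_indicator_le hv hnn (f := fun ω => f ω + min (g ω) q)
      (hf.add (hg.min measurable_const)) (B := {ω | q + 1 ≤ g ω})
      (measurableSet_le measurable_const hg) m
    have e : ∀ ω, f ω + min (g ω) q + {ω | q + 1 ≤ g ω}.indicator 1 ω
        = f ω + min (g ω) (q + 1) := by
      intro ω
      by_cases hω : q + 1 ≤ g ω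
      · simp only [indicator_of_mem (show ω ∈ {ω | q + 1 ≤ g ω} from hω), Pi.one_apply]
        rw [min_eq_right hω, min_eq_right (q.le_succ.trans hω), add_assoc]
      · rw [indicator_of_notMem (show ω ∉ {ω | q + 1 ≤ g ω} from hω),
          min_eq_left (by omega), min_eq_left (by omega), add_zero]
    simp only [e] at h
    rw [Finset.sum_range_succ]
    linarith

theorem integral_VaRc_natCast_add_le (hw : IsCapacity w) (hsub : IsSubmodular w)
    {f g : Ω → ℕ} (hf : Measurable f) (hg : Measurable g)
    {m p : ℕ} (hm : ∀ ω, f ω ≤ m) (hp : ∀ ω, g ω ≤ p) {a : ℝ} (ha : a ∈ Ioc (0 : ℝ) 1) :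
    ∫ t in (0 : ℝ)..a, VaRc w t (fun ω => ((f ω + g ω : ℕ) : ℝ))
      ≤ (∫ t in (0 : ℝ)..a, VaRc w t (fun ω => (f ω : ℝ)))
        + ∫ t in (0 : ℝ)..a, VaRc w t (fun ω => (g ω : ℝ)) := by
  have hnn : ∀ A, MeasurableSet A → 0 ≤ min (w A) a := fun A hA =>
    le_min (hw.1.symm.le.trans (hw.2.2 .empty hA (empty_subset _))) ha.1.le
  rw [integral_VaRc_natCast hw (f := fun ω => f ω + g ω) (hf.add hg) (m := m + p)
      (fun ω => add_le_add (hm ω) (hp ω)) ha,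
    integral_VaRc_natCast hw hf (m := m + p) (fun ω => le_add_right (hm ω)) ha,
    integral_VaRc_natCast hw hg hp ha]
  exact sum_levels_add_le (min_const_submodular hw hsub a) hnn hf hg (m + p) p hp

theorem integral_VaRc_add_le (hw : IsCapacity w) (hsub : IsSubmodular w)
    (hX : Measurable X) (hY : Measurable Y)
    (hXb : ∃ M : ℝ, ∀ ω, |X ω| ≤ M) (hYb : ∃ M : ℝ, ∀ ω, |Y ω| ≤ M)
    {a : ℝ} (ha : a ∈ Ioc (0 : ℝ) 1) :
    ∫ t in (0 : ℝ)..a, VaRc w t (fun ω => X ω + Y ω)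
      ≤ (∫ t in (0 : ℝ)..a, VaRc w t X) + ∫ t in (0 : ℝ)..a, VaRc w t Y := by
  obtain ⟨M, hM⟩ := hXb
  obtain ⟨K, hK⟩ := hYb
  have hXYb : ∀ ω, |X ω + Y ω| ≤ M + K := fun ω =>
    (abs_add_le _ _).trans (add_le_add (hM ω) (hK ω))
  refine le_of_forall_pos_le_add fun ε hε => ?_
  obtain ⟨N, hN⟩ := exists_nat_gt (2 * a / ε)
  have hN0 : (0 : ℝ) < N := (div_pos (mul_pos two_pos ha.1) hε).trans hN
  have hNε : 2 * a < N * ε := (div_lt_iff₀ hε).1 hN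
  -- The integer discretisation of a bounded function at mesh `1 / N`.
  have disc : ∀ {Z : Ω → ℝ} {L : ℝ}, Measurable Z → (∀ ω, |Z ω| ≤ L) →
      ∃ f : Ω → ℕ, Measurable f ∧ (∃ m, ∀ ω, f ω ≤ m) ∧
        (∀ ω, N * Z ω + N * L ≤ f ω + 1) ∧
        ∫ t in (0 : ℝ)..a, VaRc w t (fun ω => (f ω : ℝ))
          ≤ N * (∫ t in (0 : ℝ)..a, VaRc w t Z) + N * L * a := by
    intro Z L hZ hL
    have hnn : ∀ ω, 0 ≤ N * Z ω + N * L := fun ω => by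
      have := (abs_le.1 (hL ω)).1
      nlinarith
    have hle : ∀ ω, N * Z ω + N * L ≤ N * (2 * L) := fun ω => by
      have := (abs_le.1 (hL ω)).2
      nlinarith
    have hmeas : Measurable fun ω => N * Z ω + N * L := (hZ.const_mul _).add_const _
    have hfm : Measurable fun ω => ⌊N * Z ω + N * L⌋₊ := Nat.measurable_floor.comp hmeas
    refine ⟨fun ω => ⌊N * Z ω + N * L⌋₊, hfm,
      ⟨⌊N * (2 * L)⌋₊, fun ω => Nat.floor_le_floor (hle ω)⟩,
      fun ω => (Nat.lt_floor_add_one _).le, ?_⟩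
    rw [← integral_VaRc_affine hw ⟨L, hL⟩ hN0 _ ha]
    refine integral_VaRc_mono hw (measurable_from_nat.comp hfm) hmeas
      ⟨N * (2 * L), fun ω => ?_⟩ ⟨N * (2 * L), fun ω => ?_⟩ (fun ω => Nat.floor_le (hnn ω)) ha
    · rw [abs_of_nonneg (Nat.cast_nonneg _)]
      exact (Nat.floor_le (hnn ω)).trans (hle ω)
    · rw [abs_of_nonneg (hnn ω)]
      exact hle ω
  obtain ⟨f, hf, ⟨m, hm⟩, hfX, hfE⟩ := disc hX hM
  obtain ⟨g, hg, ⟨p, hp⟩, hgY, hgE⟩ := disc hY hK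
  have hfg := integral_VaRc_natCast_add_le hw hsub hf hg hm hp ha
  have hfgb : ∃ L : ℝ, ∀ ω, |((f ω + g ω : ℕ) : ℝ)| ≤ L :=
    ⟨((m + p : ℕ) : ℝ), fun ω => by
      rw [abs_of_nonneg (Nat.cast_nonneg _)]
      exact Nat.cast_le.2 (add_le_add (hm ω) (hp ω))⟩
  have hfgm : Measurable fun ω => ((f ω + g ω : ℕ) : ℝ) := measurable_from_nat.comp (hf.add hg)
  have e1 := integral_VaRc_affine hw ⟨M + K, hXYb⟩ hN0 (N * (M + K)) ha
  have e2 := integral_VaRc_affine hw hfgb one_pos 2 ha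
  have hfgb' : ∃ L : ℝ, ∀ ω, |1 * ((f ω + g ω : ℕ) : ℝ) + 2| ≤ L := by
    obtain ⟨L, hL⟩ := hfgb
    refine ⟨L + 2, fun ω => (abs_add_le _ _).trans ?_⟩
    rw [one_mul, abs_two]
    exact add_le_add_left (hL ω) 2
  have hmain := integral_VaRc_mono hw (X := fun ω => N * (X ω + Y ω) + N * (M + K))
    (Y := fun ω => 1 * ((f ω + g ω : ℕ) : ℝ) + 2) (((hX.add hY).const_mul _).add_const _)
    ((hfgm.const_mul _).add_const _)
    ⟨N * (M + K) + N * (M + K), fun ω => (abs_add_le _ _).trans (by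
      have h0 := hXYb ω
      have : 0 ≤ M + K := (abs_nonneg _).trans h0
      rw [abs_mul, abs_of_pos hN0, abs_of_nonneg (mul_nonneg hN0.le this)]
      gcongr)⟩
    hfgb' (fun ω => by
      push_cast
      linarith [hfX ω, hgY ω]) ha
  rw [e1, e2] at hmain
  refine le_of_mul_le_mul_left ?_ hN0
  nlinarith

theorem choquetES_const_zero (hw : IsCapacity w) {a : ℝ} (ha : a ∈ Ioc (0 : ℝ) 1) :
    choquetES w a (fun _ => 0) = 0 := by
  rw [choquetES, integral_congr_Ioo (g := fun _ => 0) ha.1.le fun t ht =>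
    abs_nonpos_iff.1 (abs_VaRc_le hw ⟨ht.1.le, ht.2.trans_le ha.2⟩ fun _ => abs_zero.le)]
  simp

theorem choquetES_sum_le (hw : IsCapacity w) (hsub : IsSubmodular w) {ι : Type*}
    {Xs : ι → Ω → ℝ} (s : Finset ι) (hXs : ∀ i, Measurable (Xs i))
    (hXsb : ∀ i, ∃ M : ℝ, ∀ ω, |Xs i ω| ≤ M) {a : ℝ} (ha : a ∈ Ioc (0 : ℝ) 1) :
    choquetES w a (fun ω => ∑ i ∈ s, Xs i ω) ≤ ∑ i ∈ s, choquetES w a (Xs i) := by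
  classical
  induction s using Finset.induction_on with
  | empty => simpa using (choquetES_const_zero hw ha).le
  | insert i s hi ih =>
    choose M hM using hXsb
    simp only [Finset.sum_insert hi]
    refine le_trans ?_ (add_le_add_right ih _)
    rw [choquetES, choquetES, choquetES, ← mul_add]
    exact mul_le_mul_of_nonneg_left
      (integral_VaRc_add_le hw hsub (hXs i) (Finset.measurable_sum s fun j _ => hXs j)
        ⟨M i, hM i⟩ ⟨∑ j ∈ s, M j, fun ω => (Finset.abs_sum_le_sum_abs _ _).trans
          (Finset.sum_le_sum fun j _ => hM j ω)⟩ ha) (one_div_nonneg.2 ha.1.le)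

end

/-- For a submodular capacity `w` and levels `α_1, …, α_n ∈ (0,1]`, the inf-convolution
of `ES^w_{α_1}, …, ES^w_{α_n}` at any bounded measurable `X` equals
`ES^w_{max(α_1,…,α_n)}(X)`. -/
theorem infConvolution_choquetES {Ω : Type*} [MeasurableSpace Ω]
    (n : ℕ) (hn : 0 < n)
    (w : Set Ω → ℝ) (hw : IsCapacity w) (hsub : IsSubmodular w)
    (α : Fin n → ℝ) (hα : ∀ i, α i ∈ Set.Ioc (0 : ℝ) 1)
    (αmax : ℝ) (hαmax : IsGreatest {a : ℝ | ∃ i, a = α i} αmax)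
    (X : Ω → ℝ) (hX : Measurable X) (hXb : ∃ M : ℝ, ∀ ω, |X ω| ≤ M) :
    sInf {y : ℝ | ∃ Xs : Fin n → Ω → ℝ,
        (∀ i, Measurable (Xs i)) ∧ (∀ i, ∃ M : ℝ, ∀ ω, |Xs i ω| ≤ M) ∧
        (∀ ω, ∑ i, Xs i ω = X ω) ∧
        y = ∑ i, choquetES w (α i) (Xs i)}
      = choquetES w αmax X := by
  classical
  obtain ⟨⟨i₀, rfl⟩, hmax⟩ := hαmax
  refine IsLeast.csInf_eq ⟨⟨fun i => if i = i₀ then X else fun _ => 0, ?_, ?_, ?_, ?_⟩, ?_⟩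
  · intro i
    dsimp only
    split_ifs
    exacts [hX, measurable_const]
  · intro i
    dsimp only
    split_ifs
    exacts [hXb, ⟨0, fun _ => abs_zero.le⟩]
  · intro ω
    rw [Finset.sum_eq_single i₀ (fun i _ hi => by simp [hi]) (by simp)]
    simp
  · rw [Finset.sum_eq_single i₀
      (fun i _ hi => by simpa [hi] using choquetES_const_zero hw (hα i)) (by simp)]
    simp
  · rintro y ⟨Xs, hm, hb, hsum, rfl⟩
    have h := choquetES_sum_le hw hsub Finset.univ hm hb (hα i₀)
    simp only [hsum] at h
    exact h.trans (Finset.sum_le_sum fun i _ =>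
      choquetES_antitone hw (hb i) (hα i) (hα i₀) (hmax ⟨i, rfl⟩))
end
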